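/- There exist absolute constants c₁, c₂, ε₀ > 0 such that the following holds. Let 0 < ρ ≤ 1 and 0 < ε ≤ min(ε₀, ρ²/2), let G be a graph on n vertices that is ε-far from the ρ-IndepSet property, let r = ⌈c₁·(ρ²/ε^{3/2})·ln²(1/ε)⌉ and s = ⌈c₂·(ρ³/ε²)·ln³(1/ε)⌉ with s ≤ n, and let R be a uniformly random r-element subset and S an independently drawn uniformly random s-element subset of the vertices. Then the probability that there exist an independent set I ⊆ R with |I| ≥ ρr and a set J ⊆ S with |J| ≥ ρs such that no vertex of J is adjacent in G to any vertex of I is at most 1/3. (Together with completeness this yields a non-adaptive ε-tester for ρ-IndepSet with query complexity r² + rs = O((ρ⁵/ε^{7/2})·ln⁵(1/ε)).) -/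

import Mathlib

open Finset
open scoped Classical

/-- `I` is an independent set in the graph `G`. -/
def IsIndepSet {n : ℕ} (G : SimpleGraph (Fin n)) (I : Finset (Fin n)) : Prop :=
  ∀ u ∈ I, ∀ v ∈ I, ¬ G.Adj u v

/-- `G` on `n` vertices is `ε`-far from the `ρ`-IndepSet property: every set of `⌈ρn⌉`
vertices induces at least `ε·n²` edges (counted here as `2·ε·n²` ordered adjacent pairs). -/
def EpsFarIndep {n : ℕ} (G : SimpleGraph (Fin n)) (ρ ε : ℝ) : Prop :=
  ∀ W : Finset (Fin n), W.card = ⌈ρ * (n : ℝ)⌉₊ →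
    2 * (ε * (n : ℝ) ^ 2) ≤ (((W ×ˢ W).filter (fun p => G.Adj p.1 p.2)).card : ℝ)

namespace StarTester

lemma choose_aux (y b : ℕ) (hb : b ≤ y) : ∀ k ≤ b,
    (y - k).choose (b - k) * y ^ k ≤ y.choose b * b ^ k := by
  intro k
  induction k with
  | zero => intro _; simp
  | succ k ih =>
    intro hk
    have ih' := ih (by omega)
    have h1 : (y - (k+1)).choose (b - (k+1)) * (y - k) = (y - k).choose (b - k) * (b - k) := by
      have := Nat.add_one_mul_choose_eq (y - (k+1)) (b - (k+1))
      have e1 : y - (k+1) + 1 = y - k := by omega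
      have e2 : b - (k+1) + 1 = b - k := by omega
      rw [e1, e2] at this
      rw [mul_comm]; exact this
    have h2 : (b - k) * y ≤ b * (y - k) := by
      zify [show k ≤ b by omega, show k ≤ y by omega]
      have : (b:ℤ) ≤ y := by exact_mod_cast hb
      nlinarith [show (0:ℤ) ≤ k by positivity]
    have hpos : 0 < y - k := by omega
    refine Nat.le_of_mul_le_mul_right (c := y - k) ?_ hpos
    calc (y - (k+1)).choose (b - (k+1)) * y ^ (k+1) * (y - k)
        = ((y - (k+1)).choose (b - (k+1)) * (y - k)) * y * y ^ k := by ring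
      _ = (y - k).choose (b - k) * y ^ k * ((b - k) * y) := by rw [h1]; ring
      _ ≤ (y.choose b * b ^ k) * (b * (y - k)) := Nat.mul_le_mul ih' h2
      _ = y.choose b * b ^ (k+1) * (y - k) := by ring

lemma card_super {α : Type*} [DecidableEq α] (Y K : Finset α) (hK : K ⊆ Y) (b : ℕ)
    (hb : b ≤ #Y) :
    (#((Y.powersetCard b).filter (fun R => K ⊆ R)) : ℝ) * (#Y : ℝ) ^ #K
      ≤ ((#Y).choose b : ℝ) * (b : ℝ) ^ #K := by
  by_cases hk : #K ≤ b
  · have h1 : #((Y.powersetCard b).filter (fun R => K ⊆ R)) ≤ (#Y - #K).choose (b - #K) := by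
      rw [← card_sdiff_of_subset hK, ← card_powersetCard]
      refine card_le_card_of_injOn (fun R => R \ K) ?_ ?_
      · intro R hR
        simp only [coe_filter, mem_powersetCard, Set.mem_ofPred_eq] at hR
        rw [mem_coe, mem_powersetCard]
        refine ⟨sdiff_subset_sdiff hR.1.1 le_rfl, ?_⟩
        rw [card_sdiff_of_subset hR.2, hR.1.2]
      · intro R hR S hS h
        simp only [coe_filter, mem_powersetCard, Set.mem_ofPred_eq] at hR hS
        have h' : R \ K = S \ K := h
        rw [← sdiff_union_of_subset hR.2, ← sdiff_union_of_subset hS.2, h']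
    have h2 := choose_aux (#Y) b hb (#K) hk
    have h3 : #((Y.powersetCard b).filter (fun R => K ⊆ R)) * (#Y) ^ #K
        ≤ (#Y).choose b * b ^ #K := le_trans (Nat.mul_le_mul_right _ h1) h2
    exact_mod_cast h3
  · have : (Y.powersetCard b).filter (fun R => K ⊆ R) = ∅ := by
      apply filter_eq_empty_iff.2
      intro R hR hKR
      rw [mem_powersetCard] at hR
      have := card_le_card hKR
      omega
    rw [this]; simp; positivity

lemma avg_subset {α : Type*} [DecidableEq α] (Y : Finset α) (b : ℕ) (hb : b ≤ #Y) (hb0 : 0 < b)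
    (w : α → ℝ) (a : α → α → ℝ) (hw : ∀ x, 0 ≤ w x) (ha : ∀ x y, 0 ≤ a x y)
    (hd : ∀ x, a x x = 0) :
    ∃ X ⊆ Y, #X = b ∧ ∑ x ∈ X, w x + ∑ x ∈ X, ∑ z ∈ X, a x z ≤
      (b / #Y : ℝ) * ∑ x ∈ Y, w x + (b / #Y : ℝ) ^ 2 * ∑ x ∈ Y, ∑ z ∈ Y, a x z := by
  have hY : (0:ℝ) < #Y := by exact_mod_cast lt_of_lt_of_le hb0 hb
  have hne : (Y.powersetCard b).Nonempty := powersetCard_nonempty.2 hb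
  set c : ℝ := (b / #Y : ℝ) * ∑ x ∈ Y, w x + (b / #Y : ℝ) ^ 2 * ∑ x ∈ Y, ∑ z ∈ Y, a x z with hc
  have key : ∑ X ∈ Y.powersetCard b, (∑ x ∈ X, w x + ∑ x ∈ X, ∑ z ∈ X, a x z)
      ≤ ∑ X ∈ Y.powersetCard b, c := by
    have e1 : ∀ X ∈ Y.powersetCard b, (∑ x ∈ X, w x + ∑ x ∈ X, ∑ z ∈ X, a x z) =
        ∑ x ∈ Y, w x * (if {x} ⊆ X then 1 else 0)
        + ∑ x ∈ Y, ∑ z ∈ Y, a x z * (if {x, z} ⊆ X then 1 else 0) := by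
      intro X hX
      have hXY := (mem_powersetCard.1 hX).1
      congr 1
      · rw [← sum_subset hXY]
        · apply sum_congr rfl
          intro x hx; simp [hx]
        · intro x _ hx; simp [hx]
      · rw [← sum_subset hXY]
        · apply sum_congr rfl
          intro x hx
          rw [← sum_subset hXY]
          · apply sum_congr rfl
            intro z hz; simp [hx, hz, insert_subset_iff]
          · intro z _ hz; simp [hz, insert_subset_iff]
        · intro x _ hx; simp [hx, insert_subset_iff]
    have cnt : ∀ K ⊆ Y, ∑ X ∈ Y.powersetCard b, (if K ⊆ X then (1:ℝ) else 0)
        ≤ ((#Y).choose b : ℝ) * (b / #Y : ℝ) ^ #K := by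
      intro K hK
      have := card_super Y K hK b hb
      rw [← sum_filter, sum_const, nsmul_eq_mul, mul_one, div_pow, ← mul_div_assoc,
        le_div_iff₀ (by positivity)]
      exact this
    rw [sum_congr rfl e1, sum_add_distrib, sum_comm, sum_const, card_powersetCard, nsmul_eq_mul,
      hc, mul_add]
    apply add_le_add
    · rw [mul_sum, mul_sum]
      apply sum_le_sum
      intro x hx
      rw [← mul_sum]
      have := cnt {x} (by simpa using hx)
      rw [card_singleton, pow_one] at this
      nlinarith [mul_le_mul_of_nonneg_left this (hw x)]
    · rw [sum_comm, mul_sum, mul_sum]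
      apply sum_le_sum
      intro x hx
      rw [sum_comm, mul_sum, mul_sum]
      apply sum_le_sum
      intro z hz
      rw [← mul_sum]
      by_cases hxz : x = z
      · subst hxz; simp [hd]
      · have := cnt {x, z} (by simp [insert_subset_iff, hx, hz])
        rw [card_pair hxz] at this
        nlinarith [mul_le_mul_of_nonneg_left this (ha x z)]
  obtain ⟨X, hX, hle⟩ := exists_le_of_sum_le hne key
  rw [mem_powersetCard] at hX
  exact ⟨X, hX.1, hX.2, hle⟩

/-- Chernoff-type tail. -/
lemma tail {n : ℕ} (hn : 0 < n) (r : ℕ) (hr : r ≤ n) (ρ g : ℝ) (hρ : 0 < ρ)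
    (hg : 0 ≤ g) (F C : Finset (Fin n)) (hFC : Disjoint F C) (hC : (#C : ℝ) ≤ (ρ - g) * n) :
    (#((((univ : Finset (Fin n)).powersetCard r)).filter
      (fun R => F ⊆ R ∧ ρ * r - #F ≤ (#(R ∩ C) : ℝ))) : ℝ)
      ≤ (n.choose r : ℝ) * ((r : ℝ) / n) ^ #F * Real.exp (#F - r * g ^ 2 / (2 * ρ)) := by
  have hn' : (0:ℝ) < n := by exact_mod_cast hn
  have hgρ : g ≤ ρ := by
    have : 0 ≤ (ρ - g) * n := le_trans (by positivity) hC
    by_contra h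
    push Not at h
    nlinarith
  set lam := g / ρ with hlam
  have hl0 : 0 ≤ lam := by positivity
  have hl1 : lam ≤ 1 := by rw [hlam, div_le_one hρ]; exact hgρ
  set θ := lam - lam ^ 2 / 2 with hθ
  have hθ0 : 0 ≤ θ := by nlinarith
  have hθ1 : θ ≤ 1 := by nlinarith
  have hexp : Real.exp θ ≤ 1 + lam := by
    rw [← Real.le_log_iff_exp_le (by positivity)]
    refine le_trans ?_ (Real.le_log_one_add_of_nonneg hl0)
    rw [le_div_iff₀ (by positivity)]
    have : 0 ≤ lam ^ 3 := by positivity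
    nlinarith
  set T := (((univ : Finset (Fin n)).powersetCard r)).filter
      (fun R => F ⊆ R ∧ ρ * r - #F ≤ (#(R ∩ C) : ℝ)) with hT
  set P := ((univ : Finset (Fin n)).powersetCard r) with hP
  -- markov
  have m1 : (#T : ℝ) * Real.exp (θ * (ρ * r - #F)) ≤
      ∑ R ∈ P.filter (fun R => F ⊆ R), (1 + lam) ^ #(R ∩ C) := by
    have : (#T : ℝ) * Real.exp (θ * (ρ * r - #F)) ≤ ∑ R ∈ T, (1 + lam) ^ #(R ∩ C) := by
      rw [← nsmul_eq_mul]
      apply card_nsmul_le_sum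
      intro R hR
      have hR' := (mem_filter.1 hR).2.2
      calc Real.exp (θ * (ρ * r - #F)) ≤ Real.exp (#(R ∩ C) * θ) := by
            apply Real.exp_le_exp.2
            nlinarith [mul_le_mul_of_nonneg_left hR' hθ0]
        _ = Real.exp θ ^ #(R ∩ C) := by rw [Real.exp_nat_mul]
        _ ≤ _ := pow_le_pow_left₀ (Real.exp_pos _).le hexp _
    refine this.trans ?_
    apply sum_le_sum_of_subset_of_nonneg
    · intro R hR
      rw [hT, mem_filter] at hR
      exact mem_filter.2 ⟨hR.1, hR.2.1⟩
    · intro R _ _; positivity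
  have m2 : ∑ R ∈ P.filter (fun R => F ⊆ R), (1 + lam) ^ #(R ∩ C)
      ≤ (n.choose r : ℝ) * ((r : ℝ) / n) ^ #F * (1 + lam * ((r:ℝ) / n)) ^ #C := by
    have e1 : ∀ R ∈ P.filter (fun R => F ⊆ R), (1 + lam) ^ #(R ∩ C) =
        ∑ J ∈ C.powerset, lam ^ #J * (if J ⊆ R then 1 else 0) := by
      intro R _
      rw [add_comm, ← sum_pow_mul_eq_add_pow lam 1 (R ∩ C)]
      simp only [one_pow, mul_one]
      rw [← sum_subset (powerset_mono.2 (inter_subset_right : R ∩ C ⊆ C))]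
      · apply sum_congr rfl
        intro J hJ
        rw [mem_powerset] at hJ
        simp [hJ.trans inter_subset_left]
      · intro J hJ hJ'
        rw [mem_powerset] at hJ hJ'
        have : ¬ J ⊆ R := fun h => hJ' (subset_inter h hJ)
        simp [this]
    have hrn0 : (0:ℝ) ≤ (r:ℝ)/n := by positivity
    have cnt : ∀ J ∈ C.powerset, ∑ R ∈ P.filter (fun R => F ⊆ R), (if J ⊆ R then (1:ℝ) else 0)
        ≤ (n.choose r : ℝ) * ((r : ℝ) / n) ^ (#F) * ((r:ℝ)/n) ^ #J := by
      intro J hJ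
      rw [mem_powerset] at hJ
      rw [← sum_filter, sum_const, nsmul_eq_mul, mul_one, filter_filter]
      have h := card_super (univ : Finset (Fin n)) (F ∪ J) (subset_univ _) r (by simpa using hr)
      have h2 : (P.filter (fun R => F ⊆ R ∧ J ⊆ R)) = P.filter (fun R => F ∪ J ⊆ R) := by
        apply filter_congr; intro R _; rw [union_subset_iff]
      have h3 : #(F ∪ J) = #F + #J := by
        rw [card_union_of_disjoint (hFC.mono_right hJ)]
      rw [card_univ, Fintype.card_fin, h3] at h
      rw [h2, mul_assoc, ← pow_add, div_pow, ← mul_div_assoc, le_div_iff₀ (by positivity)]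
      exact h
    rw [sum_congr rfl e1, sum_comm]
    have e2 : (1 + lam * ((r:ℝ) / n)) ^ #C = ∑ J ∈ C.powerset, (lam * ((r:ℝ)/n)) ^ #J := by
      rw [add_comm, ← sum_pow_mul_eq_add_pow]; simp
    rw [e2, mul_sum]
    apply sum_le_sum
    intro J hJ
    rw [← mul_sum, mul_pow]
    calc _ ≤ lam ^ #J * ((n.choose r : ℝ) * ((r : ℝ) / n) ^ (#F) * ((r:ℝ)/n) ^ #J) :=
          mul_le_mul_of_nonneg_left (cnt J hJ) (by positivity)
      _ = _ := by ring
  have m3 : (1 + lam * ((r:ℝ) / n)) ^ #C ≤ Real.exp (lam * r * (ρ - g)) := by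
    calc (1 + lam * ((r:ℝ) / n)) ^ #C ≤ Real.exp (lam * ((r:ℝ) / n)) ^ #C := by
          apply pow_le_pow_left₀ (by positivity)
          linarith [Real.add_one_le_exp (lam * ((r:ℝ) / n))]
      _ = Real.exp (#C * (lam * ((r:ℝ) / n))) := by rw [Real.exp_nat_mul]
      _ ≤ _ := by
          apply Real.exp_le_exp.2
          calc #C * (lam * ((r:ℝ) / n)) ≤ ((ρ - g) * n) * (lam * ((r:ℝ) / n)) :=
                mul_le_mul_of_nonneg_right hC (by positivity)
            _ = _ := by field_simp
  have m4 := m1.trans (m2.trans (mul_le_mul_of_nonneg_left m3 (by positivity)))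
  rw [← le_div_iff₀ (Real.exp_pos _), mul_div_assoc, ← Real.exp_sub] at m4
  refine m4.trans (mul_le_mul_of_nonneg_left (Real.exp_le_exp.2 ?_) (by positivity))
  have h5 : lam * r * (ρ - g) - θ * (ρ * r) = - (r * g ^ 2 / (2 * ρ)) := by
    rw [hθ, hlam]; field_simp; ring
  have h6 : θ * #F ≤ #F := by
    have : (0:ℝ) ≤ #F := by positivity
    nlinarith
  nlinarith

end StarTester
namespace StarTester

section graph
variable {n : ℕ} (G : SimpleGraph (Fin n))

noncomputable def ad (u v : Fin n) : ℝ := if G.Adj u v then 1 else 0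
noncomputable def dg (A : Finset (Fin n)) (v : Fin n) : ℝ := ∑ u ∈ A, ad G v u
noncomputable def ee (A B : Finset (Fin n)) : ℝ := ∑ a ∈ A, dg G B a

lemma ad_comm (u v : Fin n) : ad G u v = ad G v u := by simp [ad, G.adj_comm]
lemma ad_nonneg (u v : Fin n) : 0 ≤ ad G u v := by unfold ad; split_ifs <;> norm_num
lemma ad_le_one (u v : Fin n) : ad G u v ≤ 1 := by unfold ad; split_ifs <;> norm_num
lemma ad_self (u : Fin n) : ad G u u = 0 := by simp [ad]
lemma dg_nonneg (A : Finset (Fin n)) (v : Fin n) : 0 ≤ dg G A v :=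
  sum_nonneg fun _ _ => ad_nonneg G _ _
lemma dg_mono {A B : Finset (Fin n)} (h : A ⊆ B) (v : Fin n) : dg G A v ≤ dg G B v :=
  sum_le_sum_of_subset_of_nonneg h fun _ _ _ => ad_nonneg G _ _
lemma dg_le_card (A : Finset (Fin n)) (v : Fin n) : dg G A v ≤ #A := by
  have := sum_le_card_nsmul A (fun u => ad G v u) 1 (fun u _ => ad_le_one G v u)
  simpa [dg] using this
lemma ee_comm (A B : Finset (Fin n)) : ee G A B = ee G B A := by
  unfold ee dg
  rw [sum_comm]
  exact sum_congr rfl fun _ _ => sum_congr rfl fun _ _ => ad_comm G _ _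
lemma ee_nonneg (A B : Finset (Fin n)) : 0 ≤ ee G A B := sum_nonneg fun _ _ => dg_nonneg G _ _
lemma ee_mono {A B A' B' : Finset (Fin n)} (h : A ⊆ A') (h' : B ⊆ B') :
    ee G A B ≤ ee G A' B' :=
  (sum_le_sum fun v _ => dg_mono G h' v).trans
    (sum_le_sum_of_subset_of_nonneg h fun _ _ _ => dg_nonneg G _ _)
lemma ee_le (A B : Finset (Fin n)) (d : ℝ) (h : ∀ a ∈ A, dg G B a ≤ d) : ee G A B ≤ #A * d := by
  have := sum_le_card_nsmul A (fun a => dg G B a) d h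
  simpa [ee] using this
lemma le_ee (A B : Finset (Fin n)) (d : ℝ) (h : ∀ a ∈ A, d ≤ dg G B a) : #A * d ≤ ee G A B := by
  have := card_nsmul_le_sum A (fun a => dg G B a) d h
  simpa [ee] using this
lemma ee_le_card (A B : Finset (Fin n)) : ee G A B ≤ #A * #B :=
  ee_le G A B _ fun a _ => dg_le_card G B a
lemma dg_union {A X : Finset (Fin n)} (h : Disjoint A X) (v : Fin n) :
    dg G (A ∪ X) v = dg G A v + dg G X v := sum_union h
lemma ee_union_left {A X : Finset (Fin n)} (h : Disjoint A X) (B : Finset (Fin n)) :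
    ee G (A ∪ X) B = ee G A B + ee G X B := sum_union h
lemma ee_union_right {A X : Finset (Fin n)} (h : Disjoint A X) (B : Finset (Fin n)) :
    ee G B (A ∪ X) = ee G B A + ee G B X := by
  rw [ee_comm, ee_union_left G h, ee_comm G A, ee_comm G X]
lemma ee_union {A X : Finset (Fin n)} (h : Disjoint A X) :
    ee G (A ∪ X) (A ∪ X) = ee G A A + 2 * ee G A X + ee G X X := by
  rw [ee_union_left G h, ee_union_right G h, ee_union_right G h, ee_comm G X A]; ring

lemma dg_eq_card (A : Finset (Fin n)) (v : Fin n) :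
    dg G A v = #(A.filter (fun u => G.Adj v u)) := by
  unfold dg ad
  rw [sum_boole]

lemma card_nonadj (A : Finset (Fin n)) (v : Fin n) :
    (#(A.filter (fun u => ¬ G.Adj v u)) : ℝ) = #A - dg G A v := by
  rw [dg_eq_card]
  have := card_filter_add_card_filter_not (s := A) (fun u => G.Adj v u)
  have h2 : (#(A.filter (fun u => G.Adj v u)) : ℝ) + #(A.filter (fun u => ¬ G.Adj v u)) = #A := by
    exact_mod_cast this
  linarith

lemma ee_eq_card (W : Finset (Fin n)) :
    ee G W W = #((W ×ˢ W).filter (fun p => G.Adj p.1 p.2)) := by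
  unfold ee dg ad
  rw [← sum_product', sum_boole]

/-- The container associated with a fingerprint sequence (newest element first). -/
noncomputable def cont : List (Fin n) → Finset (Fin n)
  | [] => univ
  | v :: l => (cont l).filter (fun u => u ≠ v ∧ ¬ G.Adj v u ∧ dg G (cont l) u ≤ dg G (cont l) v)

/-- All chosen vertices have large degree in the current container. -/
def Good (τ : ℝ) : List (Fin n) → Prop
  | [] => True
  | v :: l => Good τ l ∧ v ∈ cont G l ∧ τ ≤ dg G (cont G l) v

lemma cont_cons_subset (v : Fin n) (l : List (Fin n)) : cont G (v :: l) ⊆ cont G l :=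
  filter_subset _ _

lemma cont_cons_card (v : Fin n) (l : List (Fin n)) :
    (#(cont G (v :: l)) : ℝ) ≤ #(cont G l) - dg G (cont G l) v := by
  rw [← card_nonadj]
  have : cont G (v :: l) ⊆ (cont G l).filter (fun u => ¬ G.Adj v u) := by
    intro u hu
    rw [cont, mem_filter] at hu
    exact mem_filter.2 ⟨hu.1, hu.2.2.1⟩
  exact_mod_cast card_le_card this

lemma cont_cons_deg (v : Fin n) (l : List (Fin n)) (u : Fin n) (hu : u ∈ cont G (v :: l)) :
    dg G (cont G (v :: l)) u ≤ dg G (cont G l) v := by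
  refine (dg_mono G (cont_cons_subset G v l) u).trans ?_
  rw [cont, mem_filter] at hu
  exact hu.2.2.2

lemma not_mem_cont (l : List (Fin n)) : ∀ v ∈ l, v ∉ cont G l := by
  induction l with
  | nil => simp
  | cons w l ih =>
    intro v hv hc
    rcases List.mem_cons.1 hv with h | h
    · rw [cont, mem_filter] at hc
      exact hc.2.1 h
    · exact ih v h (cont_cons_subset G w l hc)

lemma far_add {h b : ℕ} {E : ℝ} (hfar : ∀ W : Finset (Fin n), #W = h → 2 * E ≤ ee G W W)
    {C : Finset (Fin n)} (hCb : #C + b = h) (hC : ee G C C ≤ E / 2)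
    {X : Finset (Fin n)} (hX : Disjoint C X) (hXb : #X = b) :
    3 * E / 2 ≤ 2 * ee G C X + ee G X X := by
  have := hfar (C ∪ X) (by rw [card_union_of_disjoint hX, hXb, hCb])
  rw [ee_union G hX] at this
  linarith

lemma far_avg {h b : ℕ} {E : ℝ} (hfar : ∀ W : Finset (Fin n), #W = h → 2 * E ≤ ee G W W)
    {C : Finset (Fin n)} (hCb : #C + b = h) (hb : 0 < b) (hC : ee G C C ≤ E / 2)
    {Y : Finset (Fin n)} (hY : Disjoint C Y) (hYb : b ≤ #Y) :
    3 * E / 2 ≤ 2 * ((b / #Y : ℝ) * ee G C Y) + (b / #Y : ℝ) ^ 2 * ee G Y Y := by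
  obtain ⟨X, hXY, hXb, hX⟩ := avg_subset Y b hYb hb (fun x => 2 * dg G C x) (ad G)
    (fun x => by have := dg_nonneg G C x; positivity) (ad_nonneg G) (ad_self G)
  have h1 := far_add G hfar hCb hC (hY.mono_right hXY) hXb
  rw [← mul_sum, ← mul_sum] at hX
  have e1 : ∑ x ∈ X, dg G C x = ee G C X := ee_comm G X C
  have e2 : ∑ x ∈ Y, dg G C x = ee G C Y := ee_comm G Y C
  rw [e1, e2] at hX
  have e3 : ∑ x ∈ X, ∑ z ∈ X, ad G x z = ee G X X := rfl
  have e4 : ∑ x ∈ Y, ∑ z ∈ Y, ad G x z = ee G Y Y := rfl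
  rw [e3, e4] at hX
  linarith

lemma b_lower {h b : ℕ} {E : ℝ} (hfar : ∀ W : Finset (Fin n), #W = h → 2 * E ≤ ee G W W)
    (hn : h ≤ n)
    {C : Finset (Fin n)} (hCb : #C + b = h) (hC : ee G C C ≤ E / 2) :
    3 * E / 4 ≤ b * h := by
  have h1 : b ≤ #(univ \ C) := by
    rw [card_sdiff_of_subset (subset_univ _), card_univ, Fintype.card_fin]; omega
  obtain ⟨X, hXs, hXb⟩ := exists_subset_card_eq h1
  have hd : Disjoint C X := disjoint_sdiff.mono_right hXs
  have h2 := far_add G hfar hCb hC hd hXb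
  have h3 := ee_le_card G C X
  have h4 := ee_le_card G X X
  rw [hXb] at h3 h4
  have h5 : (h:ℝ) = #C + b := by exact_mod_cast hCb.symm
  rw [h5]
  have : (0:ℝ) ≤ (b:ℝ) * b := by positivity
  nlinarith

/-- lower bound on the degree of the last chosen vertex -/
lemma deg_lower {h b : ℕ} {E : ℝ} (hE : 0 < E)
    (hfar : ∀ W : Finset (Fin n), #W = h → 2 * E ≤ ee G W W)
    {C : Finset (Fin n)} (hCb : #C + b = h) (hb : 0 < b) (hC : ee G C C ≤ E / 2)
    (v : Fin n) (l : List (Fin n)) (hCl : C ⊆ cont G (v :: l))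
    (hg : (b : ℝ) ≤ #(cont G (v :: l)) - #C) :
    (E / (2 * b * h)) * (#(cont G (v :: l)) - #C) ≤ dg G (cont G l) v := by
  set A := cont G (v :: l) with hA
  set d := dg G (cont G l) v with hd
  have hd0 : 0 ≤ d := dg_nonneg G _ _
  set Y := A \ C with hY
  have hYc : (#Y : ℝ) = #A - #C := by
    rw [hY, card_sdiff_of_subset hCl, Nat.cast_sub (card_le_card hCl)]
  have hYb : b ≤ #Y := by
    have : (b:ℝ) ≤ #Y := by rw [hYc]; exact hg
    exact_mod_cast this
  have h1 := far_avg G hfar hCb hb hC (disjoint_sdiff : Disjoint C (A \ C)) hYb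
  have hdeg : ∀ u ∈ A, dg G Y u ≤ d := fun u hu =>
    (dg_mono G sdiff_subset u).trans (cont_cons_deg G v l u hu)
  have h2 : ee G C Y ≤ #C * d := ee_le G C Y d fun u hu => hdeg u (hCl hu)
  have h3 : ee G Y Y ≤ #Y * d := ee_le G Y Y d fun u hu => hdeg u (sdiff_subset hu)
  rw [← hYc]
  have hb' : (0:ℝ) < b := by exact_mod_cast hb
  have hbY : (b:ℝ) ≤ #Y := by exact_mod_cast hYb
  have hYp : (0:ℝ) < #Y := lt_of_lt_of_le hb' hbY
  have hh : (#C:ℝ) + b = h := by exact_mod_cast hCb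
  have hC0 : (0:ℝ) ≤ #C := by positivity
  have hhp : (0:ℝ) < h := by linarith
  have h4 : 3 * E / 2 * #Y ≤ 2 * b * (#C * d) + b ^ 2 * d := by
    have h5 : 3 * E / 2 ≤ 2 * ((b / #Y : ℝ) * (#C * d)) + (b / #Y : ℝ) ^ 2 * (#Y * d) := by
      refine h1.trans (add_le_add ?_ ?_)
      · gcongr
      · gcongr
    have h6 := mul_le_mul_of_nonneg_right h5 hYp.le
    refine h6.trans (le_of_eq ?_)
    field_simp
  have h7 : 3 * E / 2 * #Y ≤ 3 * b * h * d := by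
    rw [← hh]
    have : 0 ≤ b * d := by positivity
    nlinarith [mul_nonneg this hC0, mul_nonneg this hb'.le]
  rw [div_mul_eq_mul_div, div_le_iff₀ (by positivity)]
  nlinarith

lemma len_bound {h b : ℕ} {E L : ℝ} (hE : 0 < E) (hL : 0 ≤ L)
    (hfar : ∀ W : Finset (Fin n), #W = h → 2 * E ≤ ee G W W) (hhn : h ≤ n)
    {C : Finset (Fin n)} (hCb : #C + b = h) (hb : 0 < b) (hC : ee G C C ≤ E / 2)
    (hlog : Real.log (n / b) ≤ 2 * L)
    (l : List (Fin n)) (hG : Good G (E / (2 * h)) l) (hCl : C ⊆ cont G l) :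
    (l.length : ℝ) ≤ 8 * b * h * L / E + 1 + 2 * b * h / E := by
  have hb' : (0:ℝ) < b := by exact_mod_cast hb
  have hh : (#C:ℝ) + b = h := by exact_mod_cast hCb
  have hC0 : (0:ℝ) ≤ #C := by positivity
  have hhp : (0:ℝ) < h := by linarith
  have hbl := b_lower G hfar hhn hCb hC
  set a := E / (2 * b * h) with ha
  have ha0 : 0 < a := by positivity
  have ha1 : a ≤ 1 := by
    rw [ha, div_le_one (by positivity)]; nlinarith
  have P : ∀ l : List (Fin n), C ⊆ cont G l → (b : ℝ) ≤ #(cont G l) - #C →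
      (#(cont G l) - #C : ℝ) * (1 + a) ^ l.length ≤ n := by
    intro l
    induction l with
    | nil =>
      intro _ _
      simp [cont]
    | cons v l ih =>
      intro h1 h2
      have h3 := h1.trans (cont_cons_subset G v l)
      have h4 := cont_cons_card G v l
      have h5 := deg_lower G hE hfar hCb hb hC v l h1 h2
      rw [← ha] at h5
      have h6 : (b:ℝ) ≤ #(cont G l) - #C := by
        have := dg_nonneg G (cont G l) v
        linarith
      have h7 := ih h3 h6
      rw [List.length_cons, pow_succ']
      have h8 : (#(cont G (v :: l)) - #C : ℝ) * (1 + a) ≤ #(cont G l) - #C := by nlinarith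
      calc _ = ((#(cont G (v :: l)) - #C : ℝ) * (1 + a)) * (1 + a) ^ l.length := by ring
        _ ≤ (#(cont G l) - #C : ℝ) * (1 + a) ^ l.length :=
          mul_le_mul_of_nonneg_right h8 (by positivity)
        _ ≤ n := h7
  set M := 8 * b * h * L / E with hM
  have hM0 : 0 ≤ M := by positivity
  have P' : ∀ l : List (Fin n), C ⊆ cont G l → (b : ℝ) ≤ #(cont G l) - #C →
      (l.length : ℝ) ≤ M := by
    intro l h1 h2
    have h3 := P l h1 h2
    have h4 : (b:ℝ) * (1 + a) ^ l.length ≤ n :=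
      le_trans (mul_le_mul_of_nonneg_right h2 (by positivity)) h3
    have h5 : (1 + a) ^ l.length ≤ n / b := by
      rw [le_div_iff₀ hb']; linarith
    have h6 := Real.log_le_log (by positivity) h5
    rw [Real.log_pow] at h6
    have h7 : a / 2 ≤ Real.log (1 + a) := by
      refine le_trans ?_ (Real.le_log_one_add_of_nonneg ha0.le)
      rw [div_le_div_iff₀ (by norm_num) (by positivity)]
      nlinarith
    have h8 : (l.length : ℝ) * (a / 2) ≤ 2 * L :=
      (mul_le_mul_of_nonneg_left h7 (by positivity)).trans (h6.trans hlog)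
    have h9 : M * a = 4 * L := by rw [hM, ha]; field_simp; ring
    have : (l.length : ℝ) * a ≤ M * a := by linarith
    exact le_of_mul_le_mul_right this ha0
  set τ := E / (2 * (h:ℝ)) with hτ
  have hτ0 : 0 < τ := by positivity
  have Q : ∀ l : List (Fin n), C ⊆ cont G l → Good G τ l → (#(cont G l) - #C : ℝ) < b →
      (l.length : ℝ) ≤ M + 1 + (b - (#(cont G l) - #C)) / τ := by
    intro l
    induction l with
    | nil =>
      intro _ _ h3
      have : 0 ≤ (b - (#(cont G []) - #C)) / τ := div_nonneg (by linarith) hτ0.le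
      simp only [List.length_nil, Nat.cast_zero]
      linarith
    | cons v l ih =>
      intro h1 h2 h3
      have h4 := h1.trans (cont_cons_subset G v l)
      have h5 := cont_cons_card G v l
      obtain ⟨g1, _, g3⟩ := h2
      simp only [List.length_cons, Nat.cast_add, Nat.cast_one]
      by_cases h6 : (#(cont G l) - #C : ℝ) < b
      · have h7 := ih h4 g1 h6
        have h8 : (b - (#(cont G l) - #C)) / τ + 1 ≤ (b - (#(cont G (v::l)) - #C)) / τ := by
          rw [div_add_one hτ0.ne']
          apply div_le_div_of_nonneg_right _ hτ0.le
          linarith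
        linarith
      · push Not at h6
        have h7 := P' l h4 h6
        have : 0 ≤ (b - (#(cont G (v :: l)) - #C)) / τ := div_nonneg (by linarith) hτ0.le
        linarith
  have hbt : (b:ℝ) / τ = 2 * b * h / E := by rw [hτ]; field_simp
  have hcl : (#C : ℝ) ≤ #(cont G l) := by exact_mod_cast card_le_card hCl
  by_cases h6 : (#(cont G l) - #C : ℝ) < b
  · have h7 := Q l hCl hG h6
    have h8 : (b - (#(cont G l) - #C)) / τ ≤ b / τ :=
      div_le_div_of_nonneg_right (by linarith) hτ0.le
    linarith
  · push Not at h6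
    have h7 := P' l hCl h6
    have : 0 ≤ (b:ℝ) / τ := by positivity
    linarith

end graph
end StarTester
namespace StarTester

lemma exists_max_list {n : ℕ} (P : List (Fin n) → Prop) (h0 : P [])
    (hnd : ∀ l, P l → l.Nodup) : ∃ l, P l ∧ ∀ v, ¬ P (v :: l) := by
  by_contra hcon
  push Not at hcon
  have : ∀ k : ℕ, ∃ l, P l ∧ l.length = k := by
    intro k
    induction k with
    | zero => exact ⟨[], h0, rfl⟩
    | succ k ih =>
      obtain ⟨l, hl, hk⟩ := ih
      obtain ⟨v, hv⟩ := hcon l hl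
      exact ⟨v :: l, hv, by simp [hk]⟩
  obtain ⟨l, hl, hk⟩ := this (n + 1)
  have := (hnd l hl).length_le_card
  simp at this
  omega

section graph
variable {n : ℕ} (G : SimpleGraph (Fin n))

lemma phase1 {h : ℕ} {E L : ℝ} (hE : 0 < E) (hL : 5 ≤ L)
    (hfar : ∀ W : Finset (Fin n), #W = h → 2 * E ≤ ee G W W) (hhn : h ≤ n) (hh0 : 0 < h)
    (hlog : Real.log (4 * n * h / (3 * E)) ≤ 2 * L)
    (I : Finset (Fin n)) (hI : IsIndepSet G I) (hIc : 10 * h * h * L / E < #I) :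
    ∃ l : List (Fin n), l.Nodup ∧ (∀ v ∈ l, v ∈ I) ∧ (∀ u ∈ I, u ∉ l → u ∈ cont G l) ∧
      ee G (cont G l) (cont G l) ≤ E / 2 ∧ ∃ b : ℕ, 0 < b ∧ #(cont G l) + b = h ∧
      (l.length : ℝ) + 1 ≤ 10 * b * h * L / E := by
  have hhp : (0:ℝ) < h := by exact_mod_cast hh0
  have hnp : (0:ℝ) < n := by exact_mod_cast lt_of_lt_of_le hh0 hhn
  set τ := E / (2 * (h:ℝ)) with hτ
  have hτ0 : 0 < τ := by positivity
  -- generic length bound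
  have LB : ∀ (C : Finset (Fin n)) (b : ℕ), #C + b = h → 0 < b → ee G C C ≤ E / 2 →
      ∀ l : List (Fin n), Good G τ l → C ⊆ cont G l →
      (l.length : ℝ) + 2 ≤ 10 * b * h * L / E := by
    intro C b hCb hb hC l hG hCl
    have hb' : (0:ℝ) < b := by exact_mod_cast hb
    have hbl := b_lower G hfar hhn hCb hC
    have hlog' : Real.log (n / b) ≤ 2 * L := by
      refine le_trans (Real.log_le_log (by positivity) ?_) hlog
      rw [div_le_div_iff₀ hb' (by positivity)]
      nlinarith
    have h1 := len_bound G hE (by linarith) hfar hhn hCb hb hC hlog' l hG hCl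
    set q := b * h / E with hq
    have hq1 : 3 / 4 ≤ q := by rw [hq, le_div_iff₀ hE]; linarith
    have e1 : 8 * b * h * L / E = 8 * q * L := by rw [hq]; ring
    have e2 : 10 * b * h * L / E = 10 * q * L := by rw [hq]; ring
    have e3 : 2 * b * h / E = 2 * q := by rw [hq]; ring
    rw [e1, e3] at h1
    rw [e2]
    nlinarith
  obtain ⟨l, ⟨hnd, hlI, hcov, hgood⟩, hmax⟩ := exists_max_list
    (fun l : List (Fin n) => l.Nodup ∧ (∀ v ∈ l, v ∈ I) ∧ (∀ u ∈ I, u ∉ l → u ∈ cont G l) ∧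
      Good G τ l) (by simp [cont, Good]) (fun l hl => hl.1)
  by_cases hex : (I ∩ cont G l).Nonempty
  · obtain ⟨v, hv, hvmax⟩ := exists_max_image (I ∩ cont G l) (fun u => dg G (cont G l) u) hex
    have hvI := (mem_inter.1 hv).1
    have hvC := (mem_inter.1 hv).2
    have hvl : v ∉ l := fun h => not_mem_cont G l v h hvC
    have hcov' : ∀ u ∈ I, u ∉ v :: l → u ∈ cont G (v :: l) := by
      intro u hu hul
      rw [List.mem_cons, not_or] at hul
      have huc := hcov u hu hul.2
      rw [cont, mem_filter]
      exact ⟨huc, hul.1, hI v hvI u hu, hvmax u (mem_inter.2 ⟨hu, huc⟩)⟩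
    have hnd' : (v :: l).Nodup := List.nodup_cons.2 ⟨hvl, hnd⟩
    have hlI' : ∀ u ∈ v :: l, u ∈ I := by
      intro u hu
      rcases List.mem_cons.1 hu with h | h
      · rw [h]; exact hvI
      · exact hlI u h
    have hlt : dg G (cont G l) v < τ := by
      by_contra hge
      push Not at hge
      exact hmax v ⟨hnd', hlI', hcov', hgood, hvC, hge⟩
    set C := cont G (v :: l) with hCdef
    have hdegC : ∀ u ∈ C, dg G C u ≤ τ := fun u hu =>
      (cont_cons_deg G v l u hu).trans hlt.le
    have hsub : ∀ W ⊆ C, #W ≤ h → ee G W W ≤ E / 2 := by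
      intro W hW hWh
      have h1 := ee_le G W W τ fun u hu => (dg_mono G hW u).trans (hdegC u (hW hu))
      have h2 : (#W : ℝ) ≤ h := by exact_mod_cast hWh
      have h3 : (h:ℝ) * τ = E / 2 := by rw [hτ]; field_simp
      nlinarith
    have hCh : #C < h := by
      by_contra hge
      push Not at hge
      obtain ⟨W, hW, hWc⟩ := exists_subset_card_eq hge
      have h1 := hsub W hW hWc.le
      have h2 := hfar W hWc
      linarith
    have hCC := hsub C le_rfl hCh.le
    refine ⟨v :: l, hnd', hlI', hcov', hCC, h - #C, by omega, by rw [← hCdef]; omega, ?_⟩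
    have := LB C (h - #C) (by omega) (by omega) hCC l hgood (cont_cons_subset G v l)
    simp only [List.length_cons, Nat.cast_add, Nat.cast_one] at this ⊢
    linarith
  · exfalso
    rw [not_nonempty_iff_eq_empty] at hex
    have h1 := LB ∅ h (by simp) hh0 (by simp [ee]; positivity) l hgood (empty_subset _)
    have h2 : I ⊆ l.toFinset := by
      intro u hu
      by_contra hul
      rw [List.mem_toFinset] at hul
      have : u ∈ I ∩ cont G l := mem_inter.2 ⟨hu, hcov u hu hul⟩
      rw [hex] at this
      simp at this
    have h3 := (card_le_card h2).trans (List.toFinset_card_le l)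
    have h4 : (#I : ℝ) ≤ l.length := by exact_mod_cast h3
    linarith

/-- Properties of the auxiliary superset `W` of the container. -/
def WProp (h : ℕ) (E : ℝ) (C W : Finset (Fin n)) : Prop :=
  C ⊆ W ∧ #W < h ∧ E / (8 * h) ≤ (h:ℝ) - #W ∧
    ∀ v, v ∉ W → E / 4 * (1 / ((h:ℝ) - #C) + E / (8 * h) / (2 * ((h:ℝ) - #W) ^ 2)) ≤ dg G C v

lemma exists_W {h b : ℕ} {E : ℝ} (hE : 0 < E)
    (hfar : ∀ W : Finset (Fin n), #W = h → 2 * E ≤ ee G W W) (hhn : h ≤ n)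
    {C : Finset (Fin n)} (hCb : #C + b = h) (hb : 0 < b) (hC : ee G C C ≤ E / 2)
    (hbE : (b:ℝ) ^ 2 ≤ E / 4) : ∃ W, WProp G h E C W := by
  have hb' : (0:ℝ) < b := by exact_mod_cast hb
  have hb1 : (1:ℝ) ≤ b := by exact_mod_cast hb
  have hh : (#C:ℝ) + b = h := by exact_mod_cast hCb
  have hC0 : (0:ℝ) ≤ #C := by positivity
  have hhp : (0:ℝ) < h := by linarith
  set y0 := E / (8 * (h:ℝ)) with hy0
  have hy0p : 0 < y0 := by positivity
  have hbl := b_lower G hfar hhn hCb hC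
  have low : ∀ W : Finset (Fin n), C ⊆ W → #W ≤ h → ee G C (W \ C) ≤ E / 2 →
      y0 ≤ (h:ℝ) - #W := by
    intro W hCW hWh hW
    have h1 : h - #W ≤ #(univ \ W) := by
      rw [card_sdiff_of_subset (subset_univ _), card_univ, Fintype.card_fin]; omega
    obtain ⟨X', hXs, hXb⟩ := exists_subset_card_eq h1
    have hd : Disjoint W X' := disjoint_sdiff.mono_right hXs
    have hd2 : Disjoint (W \ C) X' := hd.mono_left sdiff_subset
    have hd3 : Disjoint C (W \ C ∪ X') :=
      disjoint_union_right.2 ⟨disjoint_sdiff, hd.mono_left hCW⟩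
    have hc : #(W \ C ∪ X') = b := by
      rw [card_union_of_disjoint hd2, hXb, card_sdiff_of_subset hCW]
      have := card_le_card hCW
      omega
    have h2 := far_add G hfar hCb hC hd3 hc
    have h3 := ee_le_card G (W \ C ∪ X') (W \ C ∪ X')
    rw [hc] at h3
    rw [ee_union_right G hd2] at h2
    have h4 := ee_le_card G C X'
    rw [hXb, Nat.cast_sub hWh] at h4
    have h5 : (0:ℝ) ≤ (h:ℝ) - #W := by
      have : (#W:ℝ) ≤ h := by exact_mod_cast hWh
      linarith
    rw [hy0, div_le_iff₀ (by positivity)]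
    nlinarith
  set Φ : ℝ → ℝ := fun y => E / 4 * (1 - y / b + y0 / (2 * y)) with hΦ
  set S := (univ : Finset (Finset (Fin n))).filter (fun W => C ⊆ W ∧ #W ≤ h ∧
    y0 ≤ (h:ℝ) - #W ∧ ee G C (W \ C) ≤ Φ ((h:ℝ) - #W)) with hS
  have hCS : C ∈ S := by
    have hbc : (h:ℝ) - #C = b := by linarith
    rw [hS, mem_filter, hbc]
    refine ⟨mem_univ _, le_rfl, by omega, ?_, ?_⟩
    · rw [hy0, div_le_iff₀ (by positivity)]; nlinarith
    · have : ee G C (C \ C) = 0 := by simp [ee, dg]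
      rw [this, hΦ]
      simp only
      rw [div_self hb'.ne']
      have : 0 ≤ y0 / (2 * (b:ℝ)) := by positivity
      have : 0 ≤ 1 - 1 + y0 / (2 * (b:ℝ)) := by linarith
      positivity
  obtain ⟨W, hWS, hmax⟩ := exists_max_image S (fun W => #W) ⟨C, hCS⟩
  rw [hS, mem_filter] at hWS
  obtain ⟨-, hCW, hWh, hy, hWe⟩ := hWS
  have hWlt : #W < h := by
    rcases lt_or_eq_of_le hWh with h1 | h1
    · exact h1
    · exfalso; rw [h1] at hy; linarith
  refine ⟨W, hCW, hWlt, hy, ?_⟩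
  intro v hv
  have hbc : (h:ℝ) - #C = b := by linarith
  rw [hbc]
  set y := (h:ℝ) - #W with hydef
  have hy1 : 1 ≤ y := by
    have : (#W:ℝ) + 1 ≤ h := by exact_mod_cast hWlt
    linarith
  have hyb : y ≤ b := by
    have : (#C:ℝ) ≤ #W := by exact_mod_cast card_le_card hCW
    linarith
  have hvC : v ∉ C := fun hc => hv (hCW hc)
  have hWv : #(insert v W) = #W + 1 := card_insert_of_notMem hv
  have hyv : (h:ℝ) - #(insert v W) = y - 1 := by rw [hWv]; push_cast; linarith
  have hev : ee G C (insert v W \ C) = ee G C (W \ C) + dg G C v := by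
    have : insert v W \ C = (W \ C) ∪ {v} := by
      ext u; simp only [mem_sdiff, mem_insert, mem_union, mem_singleton]
      constructor
      · rintro ⟨h1 | h1, h2⟩
        · exact Or.inr h1
        · exact Or.inl ⟨h1, h2⟩
      · rintro (⟨h1, h2⟩ | h1)
        · exact ⟨Or.inr h1, h2⟩
        · exact ⟨Or.inl h1, h1 ▸ hvC⟩
    rw [this, ee_union_right]
    · congr 1
      rw [ee_comm]; simp [ee]
    · simp [hv]
  by_cases hcase : y0 ≤ y - 1
  · have hnot : ¬ (ee G C (insert v W \ C) ≤ Φ (y - 1)) := by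
      intro hle
      have hin : insert v W ∈ S := by
        rw [hS, mem_filter, hyv]
        exact ⟨mem_univ _, hCW.trans (subset_insert _ _), by omega, hcase, hle⟩
      have := hmax _ hin
      omega
    push Not at hnot
    rw [hev] at hnot
    have hy2 : 0 < y - 1 := by linarith
    have hdiff : Φ (y - 1) - Φ y = E / 4 * (1 / b + y0 / (2 * (y * (y - 1)))) := by
      rw [hΦ]; simp only
      have : y ≠ 0 := by linarith
      field_simp
      ring
    have hcmp : y0 / (2 * y ^ 2) ≤ y0 / (2 * (y * (y - 1))) := by
      apply div_le_div_of_nonneg_left hy0p.le (by nlinarith) (by nlinarith)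
    have : E / 4 * (1 / b + y0 / (2 * y ^ 2)) ≤ E / 4 * (1 / b + y0 / (2 * (y * (y - 1)))) := by
      apply mul_le_mul_of_nonneg_left _ (by positivity)
      linarith
    linarith
  · have hnot : ¬ (ee G C (insert v W \ C) ≤ E / 2) := by
      intro hle
      have := low _ (hCW.trans (subset_insert v W)) (by omega) hle
      rw [hyv] at this
      exact hcase this
    push Not at hnot
    rw [hev] at hnot
    have hyp : 0 < y := by linarith
    have h1 : y0 / (2 * y) ≤ 1 / 2 := by
      rw [div_le_div_iff₀ (by positivity) (by norm_num)]; linarith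
    have h2 : y0 / (2 * y ^ 2) ≤ 1 / 2 := by
      rw [div_le_div_iff₀ (by positivity) (by norm_num)]; nlinarith
    have h3 : 1 / (b:ℝ) ≤ y / b := div_le_div_of_nonneg_right hy1 hb'.le
    have h4 : ee G C (W \ C) ≤ E / 4 * (1 - y / b + y0 / (2 * y)) := hWe
    have h5 : E / 4 * (1 / b + y0 / (2 * y ^ 2)) ≤ E / 4 * (2 - (1 - y / b + y0 / (2 * y))) := by
      apply mul_le_mul_of_nonneg_left _ (by positivity)
      linarith
    linarith

/-- Vertices outside `W` not adjacent to anything in `l`. -/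
noncomputable def UU (W : Finset (Fin n)) (l : List (Fin n)) : Finset (Fin n) :=
  univ.filter (fun v => v ∉ W ∧ ∀ x ∈ l, ¬ G.Adj x v)

/-- High degree vertices of `C` into `UU`. -/
noncomputable def HH (C W : Finset (Fin n)) (q : ℝ) (l : List (Fin n)) : Finset (Fin n) :=
  C.filter (fun v => q * #(UU G W l) ≤ dg G (UU G W l) v)

def Good2 (C W : Finset (Fin n)) (q z : ℝ) : List (Fin n) → Prop
  | [] => True
  | v :: l => Good2 C W q z l ∧ v ∈ HH G C W q l ∧ z ≤ #(UU G W l)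

lemma UU_cons (W : Finset (Fin n)) (v : Fin n) (l : List (Fin n)) :
    UU G W (v :: l) = (UU G W l).filter (fun u => ¬ G.Adj v u) := by
  ext u
  simp only [UU, mem_filter, mem_univ, true_and, List.mem_cons, forall_eq_or_imp]
  tauto

lemma Good2_card (C W : Finset (Fin n)) (q z : ℝ) :
    ∀ l, Good2 G C W q z l → (#(UU G W l) : ℝ) ≤ n * Real.exp (- (q * l.length)) := by
  intro l
  induction l with
  | nil =>
    intro _
    have h1 : #(UU G W []) ≤ n := by simpa using card_le_univ (UU G W [])
    have h2 : (#(UU G W []) : ℝ) ≤ n := by exact_mod_cast h1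
    simpa using h2
  | cons v l ih =>
    rintro ⟨h1, h2, _⟩
    have h3 := ih h1
    have h4 := (mem_filter.1 h2).2
    rw [UU_cons, card_nonadj]
    have h5 : 1 - q ≤ Real.exp (-q) := by linarith [Real.add_one_le_exp (-q)]
    calc (#(UU G W l) : ℝ) - dg G (UU G W l) v ≤ (1 - q) * #(UU G W l) := by linarith
      _ ≤ Real.exp (-q) * (n * Real.exp (- (q * l.length))) :=
        mul_le_mul h5 h3 (by positivity) (Real.exp_pos _).le
      _ = n * (Real.exp (-q) * Real.exp (- (q * l.length))) := by ring
      _ = _ := by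
        rw [← Real.exp_add]; congr 2; simp only [List.length_cons]; push_cast; ring

lemma phase2 {h : ℕ} {L δ y : ℝ} (hL : 5 ≤ L) (hh0 : 0 < h) (hδ : 0 < δ)
    (hδh : δ ≤ 4 / 3 * h) (hy : 0 < y) (C W : Finset (Fin n)) (hCh : #C ≤ h)
    (hWy : (#W : ℝ) + y = h)
    (hdeg : ∀ v, v ∉ W → δ ≤ dg G C v) (hlog : Real.log (2 * n / y) ≤ 2 * L) (hn : 0 < n)
    (I : Finset (Fin n)) :
    ∃ l : List (Fin n), l.Nodup ∧ (∀ v ∈ l, v ∈ I ∧ v ∈ C) ∧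
      (l.length : ℝ) + 1 ≤ 6 * h * L / δ ∧
      ((#(univ.filter (fun v => ∀ x ∈ l, ¬ G.Adj x v)) : ℝ) ≤ h - y / 2 ∨
       ((∀ u ∈ I, u ∉ HH G C W (δ / (2 * h)) l) ∧ δ / 2 ≤ #(HH G C W (δ / (2 * h)) l))) := by
  have hhp : (0:ℝ) < h := by exact_mod_cast hh0
  have hnp : (0:ℝ) < n := by exact_mod_cast hn
  set q := δ / (2 * (h:ℝ)) with hq
  have hq0 : 0 < q := by positivity
  obtain ⟨l, ⟨hnd, hlI, hgood⟩, hmax⟩ := exists_max_list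
    (fun l : List (Fin n) => l.Nodup ∧ (∀ v ∈ l, v ∈ I ∧ v ∈ C) ∧ Good2 G C W q (y / 2) l)
    (by simp [Good2]) (fun l hl => hl.1)
  refine ⟨l, hnd, hlI, ?_, ?_⟩
  · have hone : 1 ≤ 4 / 3 * h / δ := by rw [le_div_iff₀ hδ]; linarith
    set k := h / δ with hk
    have e1 : 6 * h * L / δ = 6 * k * L := by rw [hk]; ring
    have e2 : 4 / 3 * h / δ = 4 / 3 * k := by rw [hk]; ring
    rw [e1]; rw [e2] at hone
    cases l with
    | nil => simp only [List.length_nil, Nat.cast_zero]; nlinarith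
    | cons v l =>
      obtain ⟨g1, _, g3⟩ := hgood
      have h1 := Good2_card G C W q (y / 2) l g1
      have h2 := g3.trans h1
      have h3 : Real.exp (q * l.length) ≤ 2 * n / y := by
        rw [Real.exp_neg, ← div_eq_mul_inv, le_div_iff₀ (Real.exp_pos _)] at h2
        rw [le_div_iff₀ hy]; linarith
      have h4 : q * l.length ≤ 2 * L := by
        rw [← Real.le_log_iff_exp_le (by positivity)] at h3
        linarith
      have h5 : (l.length : ℝ) ≤ 4 * k * L := by
        have : q * (4 * k * L) = 2 * L := by rw [hq, hk]; field_simp; ring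
        exact le_of_mul_le_mul_left (by linarith) hq0
      simp only [List.length_cons]; push_cast
      nlinarith
  · by_cases hu : (#(UU G W l) : ℝ) < y / 2
    · left
      have hsub : univ.filter (fun v => ∀ x ∈ l, ¬ G.Adj x v) ⊆ W ∪ UU G W l := by
        intro v hv
        rw [mem_filter] at hv
        by_cases hvW : v ∈ W
        · exact mem_union_left _ hvW
        · exact mem_union_right _ (mem_filter.2 ⟨mem_univ _, hvW, hv.2⟩)
      have h1 := (card_le_card hsub).trans (card_union_le _ _)
      have h2 : (#(univ.filter (fun v => ∀ x ∈ l, ¬ G.Adj x v)) : ℝ) ≤ #W + #(UU G W l) := by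
        exact_mod_cast h1
      linarith
    · right
      push Not at hu
      have hup : (0:ℝ) < #(UU G W l) := by linarith
      constructor
      · intro u huI huH
        have huC := (mem_filter.1 huH).1
        have hud := (mem_filter.1 huH).2
        have hul : u ∉ l := by
          intro hul
          have : dg G (UU G W l) u = 0 := by
            apply sum_eq_zero
            intro x hx
            have := (mem_filter.1 hx).2.2 u hul
            simp [ad, this]
          rw [this] at hud
          have := mul_pos hq0 hup
          linarith
        refine hmax u ⟨List.nodup_cons.2 ⟨hul, hnd⟩, ?_, hgood, huH, hu⟩
        intro v hv
        rcases List.mem_cons.1 hv with h | h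
        · rw [h]; exact ⟨huI, huC⟩
        · exact hlI v h
      · set U := UU G W l with hU
        set H := HH G C W q l with hH
        have h1 : #U * δ ≤ ee G U C := le_ee G U C δ fun v hv => hdeg v (mem_filter.1 hv).2.1
        have hHC : H ⊆ C := filter_subset _ _
        have h2 : ee G U C = ee G H U + ee G (C \ H) U := by
          rw [ee_comm, ← ee_union_left G disjoint_sdiff, union_sdiff_of_subset hHC]
        have h3 := ee_le_card G H U
        have h4 : ee G (C \ H) U ≤ #(C \ H) * (q * #U) := by
          apply ee_le
          intro v hv
          rw [mem_sdiff] at hv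
          by_contra hcon
          push Not at hcon
          exact hv.2 (mem_filter.2 ⟨hv.1, hcon.le⟩)
        have h5 : (#(C \ H) : ℝ) ≤ h := by
          exact_mod_cast (card_le_card sdiff_subset).trans hCh
        have h6 : (#(C \ H) : ℝ) * (q * #U) ≤ h * (q * #U) :=
          mul_le_mul_of_nonneg_right h5 (by positivity)
        have h7 : (h:ℝ) * (q * #U) = δ / 2 * #U := by rw [hq]; field_simp
        have h8 : δ / 2 * #U ≤ #H * #U := by linarith
        exact le_of_mul_le_mul_right h8 hup

end graph
end StarTester
namespace StarTester

section graph
variable {n : ℕ} (G : SimpleGraph (Fin n))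

noncomputable def selW (h : ℕ) (E : ℝ) (C : Finset (Fin n)) : Finset (Fin n) :=
  if hx : ∃ W, WProp G h E C W then hx.choose else ∅

noncomputable def dlt (h : ℕ) (E : ℝ) (C W : Finset (Fin n)) : ℝ :=
  E / 4 * (1 / ((h:ℝ) - #C) + E / (8 * h) / (2 * ((h:ℝ) - #W) ^ 2))

noncomputable def Cont (h : ℕ) (E : ℝ) (l₁ l₂ : List (Fin n)) : Finset (Fin n) :=
  (if E / 4 < ((h:ℝ) - #(cont G l₁)) ^ 2 then cont G l₁ else
    cont G l₁ \ HH G (cont G l₁) (selW G h E (cont G l₁))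
      (dlt h E (cont G l₁) (selW G h E (cont G l₁)) / (2 * h)) l₂) \ (l₁ ++ l₂).toFinset

/-- vertices with no neighbour in `l` -/
noncomputable def nonNbr (l : List (Fin n)) : Finset (Fin n) :=
  univ.filter (fun v => ∀ x ∈ l, ¬ G.Adj x v)

lemma fingerprint {h : ℕ} {E L : ℝ} (hE : 0 < E) (hL : 5 ≤ L)
    (hfar : ∀ W : Finset (Fin n), #W = h → 2 * E ≤ ee G W W) (hhn : h ≤ n) (hh0 : 0 < h)
    (hlog : Real.log (16 * n * h / E) ≤ 2 * L)
    (I : Finset (Fin n)) (hI : IsIndepSet G I) (hIc : 10 * h * h * L / E < #I) :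
    ∃ l₁ l₂ : List (Fin n), (l₁ ++ l₂).Nodup ∧ (∀ v ∈ l₁ ++ l₂, v ∈ I) ∧
      ((I \ (l₁ ++ l₂).toFinset ⊆ Cont G h E l₁ l₂ ∧
        ((∃ b : ℝ, 0 < b ∧ E / 4 < b ^ 2 ∧ (#(Cont G h E l₁ l₂) : ℝ) ≤ h - b ∧
          ((l₁.length + l₂.length : ℕ) : ℝ) + 1 ≤ 10 * b * h * L / E) ∨
        (∃ b δ : ℝ, 1 ≤ b ∧ b ^ 2 ≤ E / 4 ∧ E / (4 * b) ≤ δ ∧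
          (#(Cont G h E l₁ l₂) : ℝ) ≤ h - b - δ / 2 ∧
          ((l₁.length + l₂.length : ℕ) : ℝ) + 1 ≤ 34 * b * h * L / E))) ∨
      (∃ y : ℝ, E / (8 * h) ≤ y ∧ (#(nonNbr G l₂) : ℝ) ≤ h - y / 2 ∧
        (l₂.length : ℝ) + 1 ≤ 384 * h ^ 2 * y ^ 2 * L / E ^ 2)) := by
  have hhp : (0:ℝ) < h := by exact_mod_cast hh0
  have hn0 : 0 < n := lt_of_lt_of_le hh0 hhn
  have hnp : (0:ℝ) < n := by exact_mod_cast hn0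
  have hlog1 : Real.log (4 * n * h / (3 * E)) ≤ 2 * L := by
    refine le_trans (Real.log_le_log (by positivity) ?_) hlog
    rw [div_le_div_iff₀ (by positivity) hE]
    have : 0 < n * h * E := by positivity
    nlinarith
  obtain ⟨l₁, hnd1, hl1I, hcov, hCC, b, hb, hCb, hlen1⟩ :=
    phase1 G hE hL hfar hhn hh0 hlog1 I hI hIc
  set C := cont G l₁ with hCdef
  have hb1 : (1:ℝ) ≤ b := by exact_mod_cast hb
  have hb0 : (0:ℝ) < b := by linarith
  have hhC : (#C:ℝ) + b = h := by exact_mod_cast hCb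
  have hbC : (h:ℝ) - #C = b := by linarith
  have hbl := b_lower G hfar hhn hCb hCC
  by_cases hcase : E / 4 < (b:ℝ) ^ 2
  · refine ⟨l₁, [], by simpa using hnd1, by simpa using hl1I, Or.inl ?_⟩
    have hCont : Cont G h E l₁ [] = C \ l₁.toFinset := by
      rw [Cont, ← hCdef, hbC, if_pos hcase, List.append_nil]
    rw [hCont]
    refine ⟨?_, Or.inl ⟨b, hb0, hcase, ?_, ?_⟩⟩
    · intro u hu
      rw [mem_sdiff, List.append_nil, List.mem_toFinset] at hu
      rw [mem_sdiff, List.mem_toFinset]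
      exact ⟨hcov u hu.1 hu.2, hu.2⟩
    · have : (#(C \ l₁.toFinset) : ℝ) ≤ #C := by exact_mod_cast card_le_card sdiff_subset
      linarith
    · simpa using hlen1
  · have hcase' : (b:ℝ) ^ 2 ≤ E / 4 := not_lt.1 hcase
    have hex := exists_W G hE hfar hhn hCb hb hCC hcase'
    set W := selW G h E C with hWdef
    have hW : WProp G h E C W := by
      rw [hWdef, selW, dif_pos hex]; exact hex.choose_spec
    obtain ⟨hCW, hWh, hy, hdeg⟩ := hW
    set δ := dlt h E C W with hδdef
    set y := (h:ℝ) - #W with hydef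
    have hyp : 0 < y := lt_of_lt_of_le (by positivity) hy
    have hδe : δ = E / (4 * b) + E ^ 2 / (64 * h * y ^ 2) := by
      rw [hδdef, dlt, ← hydef, hbC]; field_simp; ring
    have hδ1 : E / (4 * b) ≤ δ := by rw [hδe]; linarith [show 0 ≤ E ^ 2 / (64 * h * y ^ 2) by positivity]
    have hδ2 : E ^ 2 / (64 * h * y ^ 2) ≤ δ := by rw [hδe]; linarith [show 0 ≤ E / (4 * b) by positivity]
    have hδ0 : 0 < δ := lt_of_lt_of_le (by positivity) hδ1
    have hδh : δ ≤ 4 / 3 * h := by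
      have h1 : E / (4 * b) ≤ h / 3 := by
        rw [div_le_div_iff₀ (by positivity) (by norm_num)]; nlinarith
      have h2 : E ^ 2 / (64 * h * y ^ 2) ≤ h := by
        rw [div_le_iff₀ (by positivity)]
        rw [div_le_iff₀ (by positivity)] at hy
        have : E ^ 2 ≤ (y * (8 * h)) ^ 2 := pow_le_pow_left₀ hE.le hy 2
        nlinarith
      rw [hδe]; linarith
    have hlog2 : Real.log (2 * n / y) ≤ 2 * L := by
      refine le_trans (Real.log_le_log (by positivity) ?_) hlog
      rw [div_le_div_iff₀ (by positivity) hE]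
      rw [div_le_iff₀ (by positivity)] at hy
      nlinarith
    obtain ⟨l₂, hnd2, hl2, hlen2, hor⟩ := phase2 G hL hh0 hδ0 hδh hyp C W (by omega)
      (by linarith) hdeg hlog2 hn0 I
    have hdisj : (l₁ ++ l₂).Nodup := by
      rw [List.nodup_append]
      refine ⟨hnd1, hnd2, ?_⟩
      intro a ha c hc hac
      subst hac
      exact not_mem_cont G l₁ a ha (hl2 a hc).2
    have hmem : ∀ v ∈ l₁ ++ l₂, v ∈ I := by
      intro v hv
      rcases List.mem_append.1 hv with h | h
      · exact hl1I v h
      · exact (hl2 v h).1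
    refine ⟨l₁, l₂, hdisj, hmem, ?_⟩
    rcases hor with hS | ⟨hR1, hR2⟩
    · right
      refine ⟨y, hy, hS, hlen2.trans ?_⟩
      rw [div_le_div_iff₀ hδ0 (by positivity)]
      rw [div_le_iff₀ (by positivity)] at hδ2
      have : 6 * h * L * E ^ 2 ≤ 6 * h * L * (δ * (64 * h * y ^ 2)) :=
        mul_le_mul_of_nonneg_left hδ2 (by positivity)
      linarith
    · left
      set H := HH G C W (δ / (2 * h)) l₂ with hH
      have hCont : Cont G h E l₁ l₂ = (C \ H) \ (l₁ ++ l₂).toFinset := by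
        rw [Cont, ← hCdef, hbC, if_neg hcase]
      have hHC : H ⊆ C := filter_subset _ _
      rw [hCont]
      refine ⟨?_, Or.inr ⟨b, δ, hb1, hcase', hδ1, ?_, ?_⟩⟩
      · intro u hu
        rw [mem_sdiff] at hu
        rw [mem_sdiff, mem_sdiff]
        refine ⟨⟨hcov u hu.1 ?_, hR1 u hu.1⟩, hu.2⟩
        intro hul
        exact hu.2 (by simp [hul])
      · have h1 : (#((C \ H) \ (l₁ ++ l₂).toFinset) : ℝ) ≤ #(C \ H) := by
          exact_mod_cast card_le_card sdiff_subset
        have h2 : (#(C \ H) : ℝ) = #C - #H := by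
          rw [card_sdiff_of_subset hHC, Nat.cast_sub (card_le_card hHC)]
        linarith
      · have h1 : 6 * h * L / δ ≤ 24 * b * h * L / E := by
          rw [div_le_div_iff₀ hδ0 hE]
          rw [div_le_iff₀ (by positivity)] at hδ1
          have : 6 * h * L * E ≤ 6 * h * L * (δ * (4 * b)) :=
            mul_le_mul_of_nonneg_left hδ1 (by positivity)
          linarith
        have h2 : 34 * b * h * L / E = 10 * b * h * L / E + 24 * b * h * L / E := by ring
        rw [h2]
        push_cast
        linarith

set_option maxHeartbeats 4000000 in
/-- Numerical form of the fingerprint lemma. -/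
lemma fingerprint' {ρ σ L r s : ℝ} (hn : 0 < n) (hρ : 0 < ρ) (hρ1 : ρ ≤ 1) (hσ : 0 < σ)
    (hσρ : 2 * σ ^ 2 ≤ ρ ^ 2) (hL : 5 ≤ L) (hr0 : 0 ≤ r) (hs0 : 0 ≤ s)
    (hexp : 32 ≤ σ ^ 2 * Real.exp (2 * L))
    (hr : 30000 * ρ ^ 2 * L ^ 2 ≤ r * σ ^ 3) (hs : 1000000 * ρ ^ 3 * L ^ 3 ≤ s * σ ^ 4)
    (hsn : s ≤ n) (hfar : EpsFarIndep G ρ (σ ^ 2))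
    (I : Finset (Fin n)) (hI : IsIndepSet G I) (hIc : ρ * r ≤ #I) :
    ∃ l₁ l₂ : List (Fin n), (l₁ ++ l₂).Nodup ∧ (∀ v ∈ l₁ ++ l₂, v ∈ I) ∧
      ((I \ (l₁ ++ l₂).toFinset ⊆ Cont G ⌈ρ * n⌉₊ (σ ^ 2 * n ^ 2) l₁ l₂ ∧
        ∃ g : ℝ, 0 ≤ g ∧ (#(Cont G ⌈ρ * n⌉₊ (σ ^ 2 * n ^ 2) l₁ l₂) : ℝ) ≤ (ρ - g) * n ∧
          20 * L * (((l₁.length + l₂.length : ℕ) : ℝ) + 1) ≤ r * g ^ 2 / (2 * ρ)) ∨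
      (∃ g : ℝ, 0 ≤ g ∧ (#(nonNbr G l₂) : ℝ) ≤ (ρ - g) * n ∧
          20 * L * ((l₂.length : ℝ) + 1) ≤ s * g ^ 2 / (2 * ρ))) := by
  have hnp : (0:ℝ) < n := by exact_mod_cast hn
  set h := ⌈ρ * (n:ℝ)⌉₊ with hh
  set E := σ ^ 2 * (n:ℝ) ^ 2 with hEdef
  have hE : 0 < E := by positivity
  have hσ1 : σ < 1 := by nlinarith
  have hσρ' : σ ≤ ρ := by nlinarith
  -- n is large
  have hnσ : 1000000 * ρ ^ 3 ≤ n * σ ^ 4 := by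
    have h1 : s * σ ^ 4 ≤ n * σ ^ 4 := mul_le_mul_of_nonneg_right hsn (by positivity)
    have h2 : (1:ℝ) ≤ L ^ 3 := one_le_pow₀ (by linarith)
    have h3 : 1000000 * ρ ^ 3 * 1 ≤ 1000000 * ρ ^ 3 * L ^ 3 :=
      mul_le_mul_of_nonneg_left h2 (by positivity)
    linarith
  have hnσ2 : 1000000 * ρ ≤ n * σ ^ 2 := by
    have h1 : 1000000 * ρ * (2 * σ ^ 2) ≤ 1000000 * ρ * ρ ^ 2 :=
      mul_le_mul_of_nonneg_left hσρ (by positivity)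
    have h2 : (1000000 * ρ) * σ ^ 2 ≤ (n * σ ^ 2) * σ ^ 2 := by
      have : 0 < 1000000 * ρ * σ ^ 2 := by positivity
      nlinarith
    exact le_of_mul_le_mul_right h2 (by positivity)
  have hnρ : 1000000 ≤ ρ * n := by
    have h1 : n * σ ^ 2 ≤ n * ρ ^ 2 := by
      apply mul_le_mul_of_nonneg_left _ hnp.le
      nlinarith
    have h2 : 1000000 * ρ ≤ (ρ * n) * ρ := by nlinarith
    exact le_of_mul_le_mul_right h2 hρ
  have hh1 : ρ * n ≤ h := Nat.le_ceil _
  have hh2 : (h:ℝ) ≤ ρ * n + 1 := (Nat.ceil_lt_add_one (by positivity)).le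
  have hh3 : (h:ℝ) ≤ 2 * ρ * n := by linarith
  have hhp : (0:ℝ) < h := by linarith
  have hh0 : 0 < h := by exact_mod_cast hhp
  have hhn : h ≤ n := by
    rw [hh]; apply Nat.ceil_le.2; nlinarith
  have hfar' : ∀ W : Finset (Fin n), #W = h → 2 * E ≤ ee G W W := by
    intro W hW
    rw [ee_eq_card]
    exact hfar W hW
  have hlog : Real.log (16 * n * h / E) ≤ 2 * L := by
    rw [Real.log_le_iff_le_exp (by positivity), div_le_iff₀ hE]
    have h1 : 16 * n * (h:ℝ) ≤ 32 * n ^ 2 := by nlinarith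
    have h2 : 32 * (n:ℝ) ^ 2 ≤ (σ ^ 2 * Real.exp (2 * L)) * n ^ 2 :=
      mul_le_mul_of_nonneg_right hexp (by positivity)
    rw [hEdef]; nlinarith
  have hI' : 10 * h * h * L / E < #I := by
    refine lt_of_lt_of_le ?_ hIc
    rw [div_lt_iff₀ hE, hEdef]
    have h1 : (h:ℝ) * h ≤ (2 * ρ * n) * (2 * ρ * n) := mul_le_mul hh3 hh3 hhp.le (by positivity)
    have h2 : 10 * h * h * L ≤ 10 * L * ((2 * ρ * n) * (2 * ρ * n)) := by
      have := mul_le_mul_of_nonneg_left h1 (show 0 ≤ 10 * L by linarith)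
      linarith
    refine lt_of_le_of_lt h2 ?_
    have h3 : 40 * L * ρ ^ 2 < ρ * r * σ ^ 2 := by
      have h4 : ρ * (30000 * ρ ^ 2 * L ^ 2) ≤ ρ * (r * σ ^ 3) :=
        mul_le_mul_of_nonneg_left hr hρ.le
      have h5 : 40 * L * ρ ^ 2 * σ < 30000 * L * L * ρ ^ 2 * ρ := by
        have e1 : 40 * L * ρ ^ 2 * σ ≤ 40 * L * ρ ^ 2 * ρ :=
          mul_le_mul_of_nonneg_left hσρ' (by positivity)
        have e2 : 40 * L * ρ ^ 2 * ρ < 30000 * L * L * ρ ^ 2 * ρ := by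
          have : 0 < L * ρ ^ 2 * ρ := by positivity
          nlinarith
        linarith
      have h6 : (40 * L * ρ ^ 2) * σ < (ρ * r * σ ^ 2) * σ := by nlinarith
      exact lt_of_mul_lt_mul_right h6 hσ.le
    have h7 := mul_lt_mul_of_pos_right h3 (show (0:ℝ) < n ^ 2 by positivity)
    nlinarith
  obtain ⟨l₁, l₂, hnd, hmem, hor⟩ := fingerprint G hE hL hfar' hhn hh0 hlog I hI hI'
  refine ⟨l₁, l₂, hnd, hmem, ?_⟩
  rcases hor with ⟨hcov, ⟨b, hb0, hbE, hcard, hlen⟩ | ⟨b, δ, hb1, hbE, hδ, hcard, hlen⟩⟩ |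
    ⟨y, hy, hcard, hlen⟩
  · refine Or.inl ⟨hcov, b / (2 * n), by positivity, ?_, ?_⟩
    · have hb2 : 2 ≤ b := by
        have : 16 ≤ E := by
          rw [hEdef]
          nlinarith
        nlinarith
      have : (ρ - b / (2 * n)) * n = ρ * n - b / 2 := by field_simp
      rw [this]; linarith
    · have hbσ : σ * n / 2 ≤ b := by
        apply le_of_sq_le_sq _ hb0.le
        rw [hEdef] at hbE
        nlinarith
      have e0 : 10 * b * h * L / E ≤ 20 * ρ * b * L / (σ ^ 2 * n) := by
        rw [div_le_div_iff₀ hE (by positivity), hEdef]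
        have := mul_le_mul_of_nonneg_left hh3 (show 0 ≤ 10 * b * L * (σ ^ 2 * n) by positivity)
        nlinarith
      have e1 : 20 * L * (((l₁.length + l₂.length : ℕ) : ℝ) + 1) ≤
          20 * L * (20 * ρ * b * L / (σ ^ 2 * n)) :=
        mul_le_mul_of_nonneg_left (hlen.trans e0) (by positivity)
      refine e1.trans ?_
      have e2 : r * (b / (2 * n)) ^ 2 / (2 * ρ) = r * b ^ 2 / (8 * n ^ 2 * ρ) := by
        field_simp; ring
      have e3 : 20 * L * (20 * ρ * b * L / (σ ^ 2 * n)) = 400 * ρ * b * L ^ 2 / (σ ^ 2 * n) := by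
        ring
      rw [e2, e3, div_le_div_iff₀ (by positivity) (by positivity)]
      -- 3200 ρ² b L² n² ≤ r b² σ² n
      have e4 : 3200 * ρ ^ 2 * L ^ 2 * n ≤ r * b * σ ^ 2 := by
        have f1 : r * σ ^ 2 * (σ * n / 2) ≤ r * σ ^ 2 * b :=
          mul_le_mul_of_nonneg_left hbσ (by positivity)
        have f2 := mul_le_mul_of_nonneg_right hr (show 0 ≤ (n:ℝ) / 2 by positivity)
        have f3 : 0 ≤ ρ ^ 2 * L ^ 2 * n := by positivity
        nlinarith
      have e5 := mul_le_mul_of_nonneg_right e4 (show 0 ≤ b * n by positivity)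
      nlinarith
  · have hb0 : 0 < b := by linarith
    have hδ0 : 0 < δ := lt_of_lt_of_le (by positivity) hδ
    refine Or.inl ⟨hcov, δ / (2 * n), by positivity, ?_, ?_⟩
    · have : (ρ - δ / (2 * n)) * n = ρ * n - δ / 2 := by field_simp
      rw [this]; linarith
    · have hbσ : b ≤ σ * n / 2 := by
        apply le_of_sq_le_sq _ (by positivity)
        rw [hEdef] at hbE
        nlinarith
      have e0 : 34 * b * h * L / E ≤ 68 * ρ * b * L / (σ ^ 2 * n) := by
        rw [div_le_div_iff₀ hE (by positivity), hEdef]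
        have := mul_le_mul_of_nonneg_left hh3 (show 0 ≤ 34 * b * L * (σ ^ 2 * n) by positivity)
        nlinarith
      have e1 : 20 * L * (((l₁.length + l₂.length : ℕ) : ℝ) + 1) ≤
          20 * L * (68 * ρ * b * L / (σ ^ 2 * n)) :=
        mul_le_mul_of_nonneg_left (hlen.trans e0) (by positivity)
      refine e1.trans ?_
      have e2 : r * ((E / (4 * b)) / (2 * n)) ^ 2 / (2 * ρ) ≤ r * (δ / (2 * n)) ^ 2 / (2 * ρ) := by
        gcongr
      refine le_trans ?_ e2
      have e3 : r * ((E / (4 * b)) / (2 * n)) ^ 2 / (2 * ρ) = r * σ ^ 4 * n ^ 2 / (128 * b ^ 2 * ρ) := by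
        rw [hEdef]; field_simp; ring
      have e4 : 20 * L * (68 * ρ * b * L / (σ ^ 2 * n)) = 1360 * ρ * b * L ^ 2 / (σ ^ 2 * n) := by
        ring
      rw [e3, e4, div_le_div_iff₀ (by positivity) (by positivity)]
      -- 174080 ρ² b³ L² ≤ r σ⁶ n³
      have e5 : b ^ 3 ≤ (σ * n / 2) ^ 3 := pow_le_pow_left₀ hb0.le hbσ 3
      have e6 := mul_le_mul_of_nonneg_left e5 (show 0 ≤ 174080 * ρ ^ 2 * L ^ 2 by positivity)
      have e7 := mul_le_mul_of_nonneg_right hr (show 0 ≤ σ ^ 3 * (n:ℝ) ^ 3 by positivity)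
      have e8 : 0 ≤ ρ ^ 2 * L ^ 2 * (σ ^ 3 * (n:ℝ) ^ 3) := by positivity
      nlinarith
  · have hy0 : 0 < y := lt_of_lt_of_le (by positivity) hy
    refine Or.inr ⟨y / (4 * n), by positivity, ?_, ?_⟩
    · have hy4 : 4 ≤ y := by
        refine le_trans ?_ hy
        rw [le_div_iff₀ (by positivity), hEdef]
        nlinarith [mul_le_mul_of_nonneg_right hnσ2 hnp.le]
      have : (ρ - y / (4 * n)) * n = ρ * n - y / 4 := by field_simp
      rw [this]; linarith
    · have e0 : 384 * h ^ 2 * y ^ 2 * L / E ^ 2 ≤ 1536 * ρ ^ 2 * y ^ 2 * L / (σ ^ 4 * n ^ 2) := by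
        rw [div_le_div_iff₀ (by positivity) (by positivity), hEdef]
        have h1 : (h:ℝ) ^ 2 ≤ (2 * ρ * n) ^ 2 := pow_le_pow_left₀ hhp.le hh3 2
        have := mul_le_mul_of_nonneg_left h1
          (show 0 ≤ 384 * y ^ 2 * L * (σ ^ 4 * n ^ 2) by positivity)
        nlinarith
      have e1 : 20 * L * ((l₂.length : ℝ) + 1) ≤
          20 * L * (1536 * ρ ^ 2 * y ^ 2 * L / (σ ^ 4 * n ^ 2)) :=
        mul_le_mul_of_nonneg_left (hlen.trans e0) (by positivity)
      refine e1.trans ?_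
      have e2 : s * (y / (4 * n)) ^ 2 / (2 * ρ) = s * y ^ 2 / (32 * n ^ 2 * ρ) := by
        field_simp; ring
      have e3 : 20 * L * (1536 * ρ ^ 2 * y ^ 2 * L / (σ ^ 4 * n ^ 2)) =
          30720 * ρ ^ 2 * y ^ 2 * L ^ 2 / (σ ^ 4 * n ^ 2) := by ring
      rw [e2, e3, div_le_div_iff₀ (by positivity) (by positivity)]
      have e4 : 983040 * ρ ^ 3 * L ^ 2 ≤ s * σ ^ 4 := by
        refine le_trans ?_ hs
        have : 0 ≤ ρ ^ 3 * L ^ 2 := by positivity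
        nlinarith
      have e5 := mul_le_mul_of_nonneg_right e4 (show 0 ≤ y ^ 2 * (n:ℝ) ^ 2 by positivity)
      nlinarith

end graph
end StarTester
namespace StarTester

lemma union_range {α : Type*} (X : Finset α) (m : ℕ) (P : ℕ → α → Prop)
    [∀ i, DecidablePred (P i)] (Q : α → Prop) [DecidablePred Q]
    (hQ : ∀ x, Q x → ∃ i < m, P i x) (B : ℝ)
    (h : ∀ i < m, (#(X.filter (P i)) : ℝ) ≤ B) :
    (#(X.filter Q) : ℝ) ≤ m * B := by
  have h1 : X.filter Q ⊆ (range m).biUnion (fun i => X.filter (P i)) := by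
    intro x hx
    simp only [mem_filter, mem_biUnion, mem_range] at hx ⊢
    obtain ⟨i, hi, hP⟩ := hQ x hx.2
    exact ⟨i, hi, hx.1, hP⟩
  have h2 := (card_le_card h1).trans card_biUnion_le
  have h3 : (#(X.filter Q) : ℝ) ≤ ∑ i ∈ range m, (#(X.filter (P i)) : ℝ) := by
    exact_mod_cast h2
  refine h3.trans ?_
  have h4 := sum_le_card_nsmul (range m) (fun i => (#(X.filter (P i)) : ℝ)) B
    (fun i hi => h i (mem_range.1 hi))
  simpa using h4

lemma union_list {α : Type*} {n : ℕ} (hn : 0 < n) (X : Finset α) (b : ℕ)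
    (P : List (Fin n) → α → Prop) [∀ l, DecidablePred (P l)] (Q : α → Prop) [DecidablePred Q]
    (hQ : ∀ x, Q x → ∃ l : List (Fin n), l.length = b ∧ P l x) (B : ℝ)
    (h : ∀ l : List (Fin n), l.length = b → (#(X.filter (P l)) : ℝ) * (n:ℝ) ^ b ≤ B) :
    (#(X.filter Q) : ℝ) ≤ B := by
  have hnb : (0:ℝ) < (n:ℝ) ^ b := by positivity
  have h1 : X.filter Q ⊆
      (univ : Finset (Fin b → Fin n)).biUnion (fun f => X.filter (P (List.ofFn f))) := by
    intro x hx
    simp only [mem_filter, mem_biUnion, mem_univ, true_and] at hx ⊢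
    obtain ⟨l, hl, hP⟩ := hQ x hx.2
    subst hl
    exact ⟨l.get, hx.1, by simpa using hP⟩
  have h2 := (card_le_card h1).trans card_biUnion_le
  have h3 : (#(X.filter Q) : ℝ) ≤
      ∑ f : Fin b → Fin n, (#(X.filter (P (List.ofFn f))) : ℝ) := by
    exact_mod_cast h2
  refine h3.trans ?_
  have h4 := sum_le_card_nsmul (univ : Finset (Fin b → Fin n))
    (fun f => (#(X.filter (P (List.ofFn f))) : ℝ)) (B / (n:ℝ) ^ b)
    (fun f _ => by
      rw [le_div_iff₀ hnb]
      exact h _ (by simp))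
  refine h4.trans (le_of_eq ?_)
  simp only [card_univ, Fintype.card_fun, Fintype.card_fin, nsmul_eq_mul]
  push_cast
  field_simp

/-- the numerical estimate behind both union bounds -/
lemma num_bound {L r q : ℝ} {t : ℕ} (hL : 20 ≤ L) (hr0 : 0 ≤ r) (hr : r + 1 ≤ Real.exp (5 * L))
    (hq : 20 * L * ((t:ℝ) + 1) ≤ q) : r ^ t * Real.exp (t - q) ≤ Real.exp (-(20 * L)) := by
  have h1 : r ^ t ≤ Real.exp (5 * L) ^ t := pow_le_pow_left₀ hr0 (by linarith) t
  rw [← Real.exp_nat_mul] at h1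
  calc r ^ t * Real.exp (t - q) ≤ Real.exp (t * (5 * L)) * Real.exp (t - q) :=
        mul_le_mul_of_nonneg_right h1 (Real.exp_pos _).le
    _ = Real.exp (t * (5 * L) + (t - q)) := (Real.exp_add _ _).symm
    _ ≤ _ := by
      apply Real.exp_le_exp.2
      have : (0:ℝ) ≤ t := by positivity
      nlinarith

lemma union_bound {n r s : ℕ} (hn : 0 < n) (hrn : r ≤ n) (hsn : s ≤ n) {ρ L : ℝ} (hρ : 0 < ρ)
    (hL : 20 ≤ L) (hrL : (r:ℝ) + 1 ≤ Real.exp (5 * L))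
    (Cf : List (Fin n) → List (Fin n) → Finset (Fin n))
    (hCf : ∀ l₁ l₂, Disjoint (l₁ ++ l₂).toFinset (Cf l₁ l₂))
    (Nf : List (Fin n) → Finset (Fin n))
    (Ev : Finset (Fin n) × Finset (Fin n) → Prop) [DecidablePred Ev]
    (hEv : ∀ P, Ev P → #P.1 = r → ∃ l₁ l₂ : List (Fin n), (l₁ ++ l₂).Nodup ∧
      (l₁ ++ l₂).toFinset ⊆ P.1 ∧
      ((ρ * r - #(l₁ ++ l₂).toFinset ≤ (#(P.1 ∩ Cf l₁ l₂) : ℝ) ∧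
        ∃ g : ℝ, 0 ≤ g ∧ (#(Cf l₁ l₂) : ℝ) ≤ (ρ - g) * n ∧
          20 * L * (((l₁.length + l₂.length : ℕ) : ℝ) + 1) ≤ r * g ^ 2 / (2 * ρ)) ∨
       (ρ * s ≤ (#(P.2 ∩ Nf l₂) : ℝ) ∧
        ∃ g : ℝ, 0 ≤ g ∧ (#(Nf l₂) : ℝ) ≤ (ρ - g) * n ∧
          20 * L * ((l₂.length : ℝ) + 1) ≤ s * g ^ 2 / (2 * ρ)))) :
    (#(((univ : Finset (Fin n)).powersetCard r ×ˢ (univ : Finset (Fin n)).powersetCard s).filter Ev) : ℝ)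
      ≤ ((n.choose r : ℝ) * (n.choose s : ℝ)) / 3 := by
  have hnp : (0:ℝ) < n := by exact_mod_cast hn
  set X := (univ : Finset (Fin n)).powersetCard r ×ˢ (univ : Finset (Fin n)).powersetCard s with hX
  set T := (n.choose r : ℝ) * (n.choose s : ℝ) with hT
  have hT0 : 0 ≤ T := by positivity
  let PA : ℕ → ℕ → List (Fin n) → Finset (Fin n) × Finset (Fin n) → Prop := fun _ a l P =>
    l.Nodup ∧ (∃ g : ℝ, 0 ≤ g ∧ (#(Cf (l.take a) (l.drop a)) : ℝ) ≤ (ρ - g) * n ∧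
          20 * L * ((l.length : ℝ) + 1) ≤ r * g ^ 2 / (2 * ρ)) ∧
      (l.toFinset ⊆ P.1 ∧ ρ * r - #l.toFinset ≤ (#(P.1 ∩ Cf (l.take a) (l.drop a)) : ℝ))
  let PB : List (Fin n) → Finset (Fin n) × Finset (Fin n) → Prop := fun l P =>
    l.Nodup ∧ (∃ g : ℝ, 0 ≤ g ∧ (#(Nf l) : ℝ) ≤ (ρ - g) * n ∧
          20 * L * ((l.length : ℝ) + 1) ≤ s * g ^ 2 / (2 * ρ)) ∧
      (l.toFinset ⊆ P.1 ∧ ρ * s ≤ (#(P.2 ∩ Nf l) : ℝ))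
  have hA : (#(X.filter (fun P => ∃ t < r + 1, ∃ a < r + 1, ∃ l : List (Fin n),
      l.length = t ∧ PA t a l P)) : ℝ) ≤
      ((r + 1 : ℕ) : ℝ) * (((r + 1 : ℕ) : ℝ) * (T * Real.exp (-(20 * L)))) := by
    refine union_range X (r + 1) (fun t P => ∃ a < r + 1, ∃ l : List (Fin n),
      l.length = t ∧ PA t a l P) _ (fun _ h => h) _ ?_
    intro t _
    refine union_range X (r + 1) (fun a P => ∃ l : List (Fin n),
      l.length = t ∧ PA t a l P) _ (fun _ h => h) _ ?_
    intro a _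
    refine union_list hn X t (PA t a) _ (fun _ h => h) _ ?_
    intro l hl
    by_cases hc : l.Nodup ∧ (∃ g : ℝ, 0 ≤ g ∧ (#(Cf (l.take a) (l.drop a)) : ℝ) ≤ (ρ - g) * n ∧
          20 * L * ((l.length : ℝ) + 1) ≤ r * g ^ 2 / (2 * ρ))
    · obtain ⟨hnd, g, hg0, hgC, hgL⟩ := hc
      have hsub : X.filter (PA t a l) ⊆ (((univ : Finset (Fin n)).powersetCard r).filter
          (fun R => l.toFinset ⊆ R ∧
            ρ * r - #l.toFinset ≤ (#(R ∩ Cf (l.take a) (l.drop a)) : ℝ))) ×ˢ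
          (univ : Finset (Fin n)).powersetCard s := by
        intro P hP
        rw [mem_filter, hX, mem_product] at hP
        rw [mem_product, mem_filter]
        exact ⟨⟨hP.1.1, hP.2.2.2⟩, hP.1.2⟩
      have h1 := card_le_card hsub
      rw [card_product, card_powersetCard s univ, card_univ, Fintype.card_fin] at h1
      have h1' : (#(X.filter (PA t a l)) : ℝ) ≤ (#(((univ : Finset (Fin n)).powersetCard r).filter
          (fun R => l.toFinset ⊆ R ∧
            ρ * r - #l.toFinset ≤ (#(R ∩ Cf (l.take a) (l.drop a)) : ℝ))) : ℝ) * n.choose s := by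
        exact_mod_cast h1
      have hd := hCf (l.take a) (l.drop a)
      rw [List.take_append_drop] at hd
      have h2 := tail hn r hrn ρ g hρ hg0 l.toFinset _ hd hgC
      have hcl : #l.toFinset = t := by rw [List.toFinset_card_of_nodup hnd, hl]
      have h3 := num_bound (t := t) (q := r * g ^ 2 / (2 * ρ)) hL (Nat.cast_nonneg r) hrL
        (by rw [← hl]; exact hgL)
      have h4 := mul_le_mul_of_nonneg_right h2 (show (0:ℝ) ≤ n.choose s by positivity)
      have h5 := mul_le_mul_of_nonneg_right (h1'.trans h4) (show (0:ℝ) ≤ (n:ℝ) ^ t by positivity)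
      refine h5.trans ?_
      rw [hcl]
      calc _ = T * ((r:ℝ) ^ t * Real.exp (t - r * g ^ 2 / (2 * ρ))) := by
            rw [hT, div_pow]; field_simp
        _ ≤ _ := mul_le_mul_of_nonneg_left h3 hT0
    · have : X.filter (PA t a l) = ∅ := by
        apply filter_eq_empty_iff.2
        intro P _ hP
        exact hc ⟨hP.1, hP.2.1⟩
      rw [this]
      simp only [card_empty, Nat.cast_zero, zero_mul]
      positivity
  have hB : (#(X.filter (fun P => ∃ t < r + 1, ∃ l : List (Fin n),
      l.length = t ∧ PB l P)) : ℝ) ≤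
      ((r + 1 : ℕ) : ℝ) * (T * Real.exp (-(20 * L))) := by
    refine union_range X (r + 1) (fun t P => ∃ l : List (Fin n),
      l.length = t ∧ PB l P) _ (fun _ h => h) _ ?_
    intro t _
    refine union_list hn X t PB _ (fun _ h => h) _ ?_
    intro l hl
    by_cases hc : l.Nodup ∧ (∃ g : ℝ, 0 ≤ g ∧ (#(Nf l) : ℝ) ≤ (ρ - g) * n ∧
          20 * L * ((l.length : ℝ) + 1) ≤ s * g ^ 2 / (2 * ρ))
    · obtain ⟨hnd, g, hg0, hgC, hgL⟩ := hc
      have hsub : X.filter (PB l) ⊆ (((univ : Finset (Fin n)).powersetCard r).filter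
          (fun R => l.toFinset ⊆ R)) ×ˢ
          (((univ : Finset (Fin n)).powersetCard s).filter
          (fun R => (∅ : Finset (Fin n)) ⊆ R ∧
            ρ * s - #(∅ : Finset (Fin n)) ≤ (#(R ∩ Nf l) : ℝ))) := by
        intro P hP
        rw [mem_filter, hX, mem_product] at hP
        rw [mem_product, mem_filter, mem_filter]
        refine ⟨⟨hP.1.1, hP.2.2.2.1⟩, hP.1.2, empty_subset _, ?_⟩
        simpa using hP.2.2.2.2
      have h1 := card_le_card hsub
      rw [card_product] at h1
      have h1' : (#(X.filter (PB l)) : ℝ) ≤ (#(((univ : Finset (Fin n)).powersetCard r).filter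
          (fun R => l.toFinset ⊆ R)) : ℝ) * (#(((univ : Finset (Fin n)).powersetCard s).filter
          (fun R => (∅ : Finset (Fin n)) ⊆ R ∧
            ρ * s - #(∅ : Finset (Fin n)) ≤ (#(R ∩ Nf l) : ℝ))) : ℝ) := by
        exact_mod_cast h1
      have h2 := tail hn s hsn ρ g hρ hg0 ∅ _ (disjoint_empty_left _) hgC
      have hcl : #l.toFinset = t := by rw [List.toFinset_card_of_nodup hnd, hl]
      have h0 := card_super (univ : Finset (Fin n)) l.toFinset (subset_univ _) r (by simpa using hrn)
      rw [hcl, card_univ, Fintype.card_fin] at h0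
      have h3 := num_bound (t := t) (q := s * g ^ 2 / (2 * ρ)) hL (Nat.cast_nonneg r) hrL
        (by rw [← hl]; exact hgL)
      have h2' := h2.trans (show (n.choose s:ℝ) * ((s:ℝ) / n) ^ #(∅ : Finset (Fin n)) *
          Real.exp (#(∅ : Finset (Fin n)) - s * g ^ 2 / (2 * ρ)) ≤
          (n.choose s:ℝ) * Real.exp (t - s * g ^ 2 / (2 * ρ)) by
        simp only [card_empty, pow_zero, mul_one, Nat.cast_zero]
        gcongr
        positivity)
      have h5 := mul_le_mul h0 h2' (by positivity) (by positivity)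
      have h6 := mul_le_mul_of_nonneg_right h1' (show (0:ℝ) ≤ (n:ℝ) ^ t by positivity)
      refine h6.trans ?_
      rw [mul_right_comm]
      refine h5.trans ?_
      calc _ = T * ((r:ℝ) ^ t * Real.exp (t - s * g ^ 2 / (2 * ρ))) := by
            rw [hT]; ring
        _ ≤ _ := mul_le_mul_of_nonneg_left h3 hT0
    · have : X.filter (PB l) = ∅ := by
        apply filter_eq_empty_iff.2
        intro P _ hP
        exact hc ⟨hP.1, hP.2.1⟩
      rw [this]
      simp only [card_empty, Nat.cast_zero, zero_mul]
      positivity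
  have hcov : X.filter Ev ⊆ X.filter (fun P => ∃ t < r + 1, ∃ a < r + 1, ∃ l : List (Fin n),
      l.length = t ∧ PA t a l P) ∪ X.filter (fun P => ∃ t < r + 1, ∃ l : List (Fin n),
      l.length = t ∧ PB l P) := by
    intro P hP
    rw [mem_filter] at hP
    obtain ⟨hPX, hP⟩ := hP
    have hP1 : #P.1 = r := (mem_powersetCard.1 (mem_product.1 hPX).1).2
    obtain ⟨l₁, l₂, hnd, hsub, hor⟩ := hEv P hP hP1
    have hlen : l₁.length + l₂.length ≤ r := by
      have := card_le_card hsub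
      rw [List.toFinset_card_of_nodup hnd, List.length_append, hP1] at this
      exact this
    rw [mem_union, mem_filter, mem_filter]
    rcases hor with ⟨hc, g, hg0, hgC, hgL⟩ | ⟨hc, g, hg0, hgC, hgL⟩
    · refine Or.inl ⟨hPX, l₁.length + l₂.length, by omega, l₁.length, by omega, l₁ ++ l₂,
        by simp, hnd, ⟨g, hg0, ?_, ?_⟩, hsub, ?_⟩
      · simpa using hgC
      · rw [List.length_append]; exact hgL
      · simpa using hc
    · refine Or.inr ⟨hPX, l₂.length, by omega, l₂, rfl, (List.nodup_append.1 hnd).2.1,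
        ⟨g, hg0, hgC, hgL⟩, ?_, hc⟩
      refine Subset.trans ?_ hsub
      rw [List.toFinset_append]
      exact subset_union_right
  have h1 := (card_le_card hcov).trans (card_union_le _ _)
  have h2 : (#(X.filter Ev) : ℝ) ≤ ((r + 1 : ℕ) : ℝ) * (((r + 1 : ℕ) : ℝ) * (T * Real.exp (-(20 * L))))
      + ((r + 1 : ℕ) : ℝ) * (T * Real.exp (-(20 * L))) := by
    refine le_trans ?_ (add_le_add hA hB)
    exact_mod_cast h1
  refine h2.trans ?_
  push_cast
  have hw1 : (1:ℝ) ≤ (r:ℝ) + 1 := by have : (0:ℝ) ≤ r := by positivity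
                                     linarith
  have hsq : ((r:ℝ) + 1) * ((r:ℝ) + 1) ≤ Real.exp (10 * L) := by
    calc ((r:ℝ) + 1) * ((r:ℝ) + 1) ≤ Real.exp (5 * L) * Real.exp (5 * L) :=
          mul_le_mul hrL hrL (by positivity) (Real.exp_pos _).le
      _ = Real.exp (10 * L) := by rw [← Real.exp_add]; congr 1; ring
  have he : Real.exp (10 * L) * Real.exp (-(20 * L)) ≤ 1 / 6 := by
    rw [← Real.exp_add]
    have e1 : 10 * L + -(20 * L) = -(10 * L) := by ring
    rw [e1, Real.exp_neg, ← one_div]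
    apply one_div_le_one_div_of_le (by norm_num)
    have := Real.add_one_le_exp (10 * L)
    linarith
  have hex := Real.exp_pos (-(20 * L))
  have h7 : ((r:ℝ) + 1) * ((r:ℝ) + 1) * Real.exp (-(20 * L)) ≤ 1 / 6 :=
    (mul_le_mul_of_nonneg_right hsq hex.le).trans he
  have h8 : ((r:ℝ) + 1) * Real.exp (-(20 * L)) ≤ 1 / 6 := by
    refine le_trans ?_ h7
    apply mul_le_mul_of_nonneg_right _ hex.le
    nlinarith
  have h9 := mul_le_mul_of_nonneg_left (add_le_add h7 h8) hT0
  calc _ = T * (((r:ℝ) + 1) * ((r:ℝ) + 1) * Real.exp (-(20 * L)) +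
        ((r:ℝ) + 1) * Real.exp (-(20 * L))) := by ring
    _ ≤ _ := h9
    _ = T / 3 := by ring

end StarTester
/-- **Soundness of the independent-set-star tester.** There are absolute constants
`c₁, c₂, ε₀ > 0` such that for all `0 < ρ ≤ 1`, `0 < ε ≤ min(ε₀, ρ²/2)`, every graph `G` on
`n` vertices that is `ε`-far from the `ρ`-IndepSet property, and
`r = ⌈c₁·(ρ²/ε^{3/2})·ln²(1/ε)⌉`, `s = ⌈c₂·(ρ³/ε²)·ln³(1/ε)⌉` with `s ≤ n`, the probability
(over independent uniformly random subsets `R` of size `r` and `S` of size `s`) that there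
are an independent set `I ⊆ R` with `|I| ≥ ρr` and a set `J ⊆ S` with `|J| ≥ ρs` having no
vertex adjacent to any vertex of `I` is at most `1/3`. -/
theorem indep_set_star_soundness :
    ∃ c₁ c₂ ε₀ : ℝ, 0 < c₁ ∧ 0 < c₂ ∧ 0 < ε₀ ∧
      ∀ (n : ℕ) (ρ ε : ℝ) (G : SimpleGraph (Fin n)) (r s : ℕ),
        0 < ρ → ρ ≤ 1 →
        0 < ε → ε ≤ min ε₀ (ρ ^ 2 / 2) →
        EpsFarIndep G ρ ε →
        r = ⌈c₁ * (ρ ^ 2 / ε ^ ((3 : ℝ) / 2)) * (Real.log (1 / ε)) ^ 2⌉₊ →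
        s = ⌈c₂ * (ρ ^ 3 / ε ^ 2) * (Real.log (1 / ε)) ^ 3⌉₊ →
        s ≤ n →
        (((((Finset.univ : Finset (Fin n)).powersetCard r) ×ˢ
            ((Finset.univ : Finset (Fin n)).powersetCard s)).filter
          (fun P => ∃ I ⊆ P.1, IsIndepSet G I ∧ ρ * (r : ℝ) ≤ (I.card : ℝ) ∧
            ∃ J ⊆ P.2, ρ * (s : ℝ) ≤ (J.card : ℝ) ∧
              ∀ v ∈ J, ∀ u ∈ I, ¬ G.Adj v u)).card : ℝ) ≤
          ((n.choose r : ℝ) * (n.choose s : ℝ)) / 3 := by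
  refine ⟨30000, 1000000, Real.exp (-20), by norm_num, by norm_num, Real.exp_pos _, ?_⟩
  intro n ρ ε G r s hρ hρ1 hε hεm hfar hrdef hsdef hsn
  have hε0 : ε ≤ Real.exp (-20) := hεm.trans (min_le_left _ _)
  have hερ : ε ≤ ρ ^ 2 / 2 := hεm.trans (min_le_right _ _)
  set L := Real.log (1 / ε) with hLdef
  have heL : Real.exp L = 1 / ε := Real.exp_log (by positivity)
  have hL : 20 ≤ L := by
    rw [hLdef, Real.le_log_iff_exp_le (by positivity), le_div_iff₀ hε]
    calc Real.exp 20 * ε ≤ Real.exp 20 * Real.exp (-20) :=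
          mul_le_mul_of_nonneg_left hε0 (Real.exp_pos _).le
      _ = 1 := by rw [← Real.exp_add]; simp
  set σ := Real.sqrt ε with hσdef
  have hσ : 0 < σ := Real.sqrt_pos.2 hε
  have hσ2 : σ ^ 2 = ε := Real.sq_sqrt hε.le
  have hσ3 : ε ^ ((3:ℝ) / 2) = σ ^ 3 := by
    rw [hσdef, Real.sqrt_eq_rpow, ← Real.rpow_natCast, ← Real.rpow_mul hε.le]
    norm_num
  have hσ4 : ε ^ 2 = σ ^ 4 := by rw [← hσ2]; ring
  rw [hσ3] at hrdef
  rw [hσ4] at hsdef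
  have hr : 30000 * ρ ^ 2 * L ^ 2 ≤ r * σ ^ 3 := by
    have h1 : 30000 * (ρ ^ 2 / σ ^ 3) * L ^ 2 ≤ r := by rw [hrdef]; exact Nat.le_ceil _
    have h2 := mul_le_mul_of_nonneg_right h1 (show 0 ≤ σ ^ 3 by positivity)
    refine le_trans (le_of_eq ?_) h2
    field_simp
  have hs : 1000000 * ρ ^ 3 * L ^ 3 ≤ s * σ ^ 4 := by
    have h1 : 1000000 * (ρ ^ 3 / σ ^ 4) * L ^ 3 ≤ s := by rw [hsdef]; exact Nat.le_ceil _
    have h2 := mul_le_mul_of_nonneg_right h1 (show 0 ≤ σ ^ 4 by positivity)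
    refine le_trans (le_of_eq ?_) h2
    field_simp
  have hs0 : 0 < s := by
    rcases Nat.eq_zero_or_pos s with h | h
    · rw [h] at hs
      have : 0 < 1000000 * ρ ^ 3 * L ^ 3 := by positivity
      simp at hs
      linarith
    · exact h
  have hn : 0 < n := by omega
  by_cases hrn : r ≤ n
  swap
  · have : (Finset.univ : Finset (Fin n)).powersetCard r = ∅ := by
      apply powersetCard_eq_empty.2
      simpa using hrn
    rw [this]
    simp only [empty_product, filter_empty, card_empty, Nat.cast_zero]
    positivity
  have hrL : (r:ℝ) + 1 ≤ Real.exp (5 * L) := by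
    have h1 : (r:ℝ) ≤ 30000 * (ρ ^ 2 / σ ^ 3) * L ^ 2 + 1 := by
      rw [hrdef]; exact (Nat.ceil_lt_add_one (by positivity)).le
    have hσ1 : σ ≤ 1 := by
      rw [hσdef]; apply Real.sqrt_le_one.2
      nlinarith
    have h2 : ρ ^ 2 / σ ^ 3 ≤ Real.exp (2 * L) := by
      have : Real.exp (2 * L) = 1 / σ ^ 4 := by
        rw [← hσ4, two_mul, Real.exp_add, heL]; field_simp
      rw [this]
      apply div_le_div₀ (by norm_num) (by nlinarith) (by positivity)
      exact pow_le_pow_of_le_one hσ.le hσ1 (by norm_num)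
    have h3 : L ^ 2 ≤ 2 * Real.exp L := by
      have := Real.quadratic_le_exp_of_nonneg (show 0 ≤ L by linarith)
      nlinarith
    have h4 : 30000 * (ρ ^ 2 / σ ^ 3) * L ^ 2 ≤ 60000 * Real.exp (3 * L) := by
      calc 30000 * (ρ ^ 2 / σ ^ 3) * L ^ 2 ≤ 30000 * Real.exp (2 * L) * (2 * Real.exp L) := by
            gcongr
        _ = 60000 * (Real.exp (2 * L) * Real.exp L) := by ring
        _ = 60000 * Real.exp (3 * L) := by rw [← Real.exp_add]; congr 2; ring
    have h5 : 100000 ≤ Real.exp (2 * L) := by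
      have h6 : (2:ℝ) ≤ Real.exp 1 := by have := Real.add_one_le_exp (1:ℝ); linarith
      have h7 : Real.exp 20 ≤ Real.exp (2 * L) := Real.exp_le_exp.2 (by linarith)
      have h8 : Real.exp 20 = Real.exp 1 ^ 20 := by rw [← Real.exp_nat_mul]; norm_num
      have h9 : (2:ℝ) ^ 20 ≤ Real.exp 1 ^ 20 := pow_le_pow_left₀ (by norm_num) h6 20
      norm_num at h9
      linarith
    have h6 : Real.exp (5 * L) = Real.exp (2 * L) * Real.exp (3 * L) := by
      rw [← Real.exp_add]; congr 1; ring
    have h7 : 1 ≤ Real.exp (3 * L) := Real.one_le_exp (by linarith)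
    rw [h6]
    have h8 := mul_le_mul_of_nonneg_right h5 (show 0 ≤ Real.exp (3 * L) by positivity)
    linarith
  have hexp : 32 ≤ σ ^ 2 * Real.exp (2 * L) := by
    have h1 : σ ^ 2 * Real.exp (2 * L) = Real.exp L := by
      rw [hσ2, two_mul, Real.exp_add, heL]; field_simp
    rw [h1]
    have := Real.quadratic_le_exp_of_nonneg (show 0 ≤ L by linarith)
    nlinarith
  rw [← hσ2] at hfar
  refine StarTester.union_bound hn hrn hsn hρ hL hrL
    (StarTester.Cont G ⌈ρ * n⌉₊ (σ ^ 2 * n ^ 2)) ?_ (StarTester.nonNbr G) _ ?_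
  · intro l₁ l₂
    unfold StarTester.Cont
    exact disjoint_sdiff
  · rintro ⟨R, S⟩ ⟨I, hIR, hI, hIc, J, hJS, hJc, hJI⟩ hR
    obtain ⟨l₁, l₂, hnd, hmem, hor⟩ := StarTester.fingerprint' G hn hρ hρ1 hσ
      (by rw [hσ2]; linarith) (show 5 ≤ L by linarith) (Nat.cast_nonneg r) (Nat.cast_nonneg s)
      hexp hr hs (by exact_mod_cast hsn) hfar I hI hIc
    have hFI : (l₁ ++ l₂).toFinset ⊆ I := by
      intro v hv
      exact hmem v (List.mem_toFinset.1 hv)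
    refine ⟨l₁, l₂, hnd, hFI.trans hIR, ?_⟩
    rcases hor with ⟨hcov, hg⟩ | hg
    · refine Or.inl ⟨?_, hg⟩
      have h1 : I \ (l₁ ++ l₂).toFinset ⊆
          R ∩ StarTester.Cont G ⌈ρ * n⌉₊ (σ ^ 2 * n ^ 2) l₁ l₂ :=
        subset_inter (sdiff_subset.trans hIR) hcov
      have h2 := card_le_card h1
      have h3 := card_sdiff_add_card_eq_card hFI
      have h4 : (#I : ℝ) ≤ #(R ∩ StarTester.Cont G ⌈ρ * n⌉₊ (σ ^ 2 * n ^ 2) l₁ l₂) +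
          #(l₁ ++ l₂).toFinset := by
        rw [← h3]; push_cast
        have : (#(I \ (l₁ ++ l₂).toFinset) : ℝ) ≤
          #(R ∩ StarTester.Cont G ⌈ρ * n⌉₊ (σ ^ 2 * n ^ 2) l₁ l₂) := by exact_mod_cast h2
        linarith
      show ρ * (r:ℝ) - #(l₁ ++ l₂).toFinset ≤
        (#(R ∩ StarTester.Cont G ⌈ρ * n⌉₊ (σ ^ 2 * n ^ 2) l₁ l₂) : ℝ)
      linarith
    · refine Or.inr ⟨?_, hg⟩
      have h1 : J ⊆ S ∩ StarTester.nonNbr G l₂ := by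
        refine subset_inter hJS ?_
        intro v hv
        rw [StarTester.nonNbr, mem_filter]
        refine ⟨mem_univ _, fun x hx hadj => ?_⟩
        exact hJI v hv x (hmem x (List.mem_append_right _ hx)) hadj.symm
      have h2 : (#J : ℝ) ≤ #(S ∩ StarTester.nonNbr G l₂) := by exact_mod_cast card_le_card h1
      exact hJc.trans h2
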